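/- Let ρ ∈ ℂ with |ρ| ≤ 1 and let (X_N) be the jointly Gaussian elliptic random band matrices on increasing undirected d_N-regular graphs with d_N/(log N)³ → ∞ described in the context. Then for every ε > 0, almost surely, for all sufficiently large N every eigenvalue of d_N^{−1/2}·X_N lies in 𝓔_{ρ,ε}. -/

import Mathlib

open MeasureTheory ProbabilityTheory Filter Matrix
open scoped ENNReal Classical

noncomputable section

/-- The elliptic region 𝓔_ρ. -/
def ellipticSet (ρ : ℂ) : Set ℂ :=
  {z | ∃ x : ℂ, ‖x‖ ≤ 1 ∧ z = x + ρ * (starRingEnd ℂ) x}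

/-- The ε-neighborhood 𝓔_{ρ,ε}. -/
def ellipticNbhd (ρ : ℂ) (ε : ℝ) : Set ℂ :=
  {z | Metric.infDist z (ellipticSet ρ) ≤ ε}

/-- Eigenvalues with multiplicity: the roots of the characteristic polynomial. -/
def eigs {N : ℕ} (M : Matrix (Fin N) (Fin N) ℂ) : Multiset ℂ :=
  M.charpoly.roots

/-- Operator (ℓ²→ℓ²) norm of a complex matrix. -/
def opNorm {m n : Type*} [Fintype m] [Fintype n] [DecidableEq n] (M : Matrix m n ℂ) : ℝ :=
  ‖LinearMap.toContinuousLinearMap (Matrix.toEuclideanLin M)‖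

/-- The elliptic Gaussian band model with parameter ρ: undirected increasing d_N-regular
graphs G_N = ([N], E_N); `Y x y` is the common entry at position (x,y) of all the matrices
X_N (N > max(x,y)), which are centered jointly Gaussian, with unit variance and pairwise
covariance ρ across each edge, i.i.d. variance-one diagonal on self-loops, vanishing off the
edge set, and independent across distinct edges. -/
structure EllipticGaussianBandModel (Ω : Type) [MeasurableSpace Ω] (μ : Measure Ω)
    (ρ : ℂ) (d : ℕ → ℕ) (E : ℕ → Finset (ℕ × ℕ)) (Y : ℕ → ℕ → Ω → ℂ) : Prop where
  rho_le : ‖ρ‖ ≤ 1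
  deg_ge : ∀ N, 1 ≤ N → 1 ≤ d N
  deg_le : ∀ N, d N ≤ N
  deg_growth : Tendsto (fun N => (d N : ℝ) / (Real.log N) ^ 3) atTop atTop
  edges_lt : ∀ N, ∀ e ∈ E N, e.1 < N ∧ e.2 < N
  edges_mono : ∀ N, E N ⊆ E (N + 1)
  edges_symm : ∀ N x y, (x, y) ∈ E N ↔ (y, x) ∈ E N
  degree : ∀ N, ∀ x < N, ((E N).filter (fun e => e.1 = x)).card = d N
  loops : ∀ N, (∀ x < N, (x, x) ∈ E N) ∨ (∀ x < N, (x, x) ∉ E N)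
  sparsity : ∀ N, ∀ x < N, ∀ y < N, (x, y) ∉ E N → ∀ ω, Y x y ω = 0
  jointly_gaussian : ∀ N : ℕ, ∃ (n : ℕ) (A : Fin n → Matrix (Fin N) (Fin N) ℂ)
      (g : Fin n → Ω → ℝ),
      (∀ i, Measurable (g i) ∧ Measure.map (g i) μ = gaussianReal 0 1) ∧
      iIndepFun g μ ∧
      ∀ ω (x y : Fin N), Y x y ω = ∑ i, (g i ω : ℂ) * A i x y
  offdiag_var : ∀ x y : ℕ, x ≠ y → (∃ N, (x, y) ∈ E N) →
      (∫ ω, (‖Y x y ω‖ : ℝ) ^ 2 ∂μ) = 1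
  offdiag_cov : ∀ x y : ℕ, x ≠ y → (∃ N, (x, y) ∈ E N) →
      (∫ ω, Y x y ω * Y y x ω ∂μ) = ρ
  diag_centered : ∀ x : ℕ, (∃ N, (x, x) ∈ E N) → (∫ ω, Y x x ω ∂μ) = 0
  diag_var : ∀ x : ℕ, (∃ N, (x, x) ∈ E N) →
      (∫ ω, (‖Y x x ω‖ : ℝ) ^ 2 ∂μ) = 1
  diag_ident : ∀ x y : ℕ, (∃ N, (x, x) ∈ E N) → (∃ N, (y, y) ∈ E N) →
      Measure.map (fun ω => Y x x ω) μ = Measure.map (fun ω => Y y y ω) μ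
  edge_indep : iIndepFun
      (fun (p : {p : ℕ × ℕ // p.1 ≤ p.2}) ω => (Y p.1.1 p.1.2 ω, Y p.1.2 p.1.1 ω)) μ

/-- The N×N matrix X_N extracted from the compatible family of entries Y. -/
def bandMatrix {Ω : Type} (Y : ℕ → ℕ → Ω → ℂ) (N : ℕ) (ω : Ω) :
    Matrix (Fin N) (Fin N) ℂ :=
  Matrix.of fun x y => Y (x : ℕ) (y : ℕ) ω

section CCR

open scoped InnerProductSpace ComplexConjugate

/-- Annihilation operators `a i` and creation operators `c i` satisfying the canonical
commutation relations, compatible with a degree filtration `V`. -/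
structure IsCCR {ι P : Type*} [SeminormedAddCommGroup P] [InnerProductSpace ℂ P]
    (a c : ι → P →ₗ[ℂ] P) (V : ℕ → Submodule ℂ P) : Prop where
  adjoint : ∀ i p q, ⟪a i p, q⟫_ℂ = ⟪p, c i q⟫_ℂ
  comm : ∀ i j p, a i (c j p) = c j (a i p) + if i = j then p else 0
  ann_comm : ∀ i j p, a i (a j p) = a j (a i p)
  ann_mem : ∀ i D p, p ∈ V (D + 1) → a i p ∈ V D
  ann_zero : ∀ i p, p ∈ V 0 → a i p = 0
  mono : Monotone V
  cre_mem : ∀ i D p, p ∈ V D → c i p ∈ V (D + 1)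

variable {ι P : Type*} [SeminormedAddCommGroup P] [InnerProductSpace ℂ P]
  {a c : ι → P →ₗ[ℂ] P} {V : ℕ → Submodule ℂ P}

theorem IsCCR.adjoint' (h : IsCCR a c V) (i : ι) (p q : P) :
    ⟪c i p, q⟫_ℂ = ⟪p, a i q⟫_ℂ := by
  rw [← inner_conj_symm, ← h.adjoint, inner_conj_symm]

theorem IsCCR.ann_mem_self (h : IsCCR a c V) (i : ι) {D : ℕ} {p : P} (hp : p ∈ V D) :
    a i p ∈ V D := h.ann_mem i D p (h.mono (Nat.le_succ D) hp)

theorem norm_sq_sum_eq_re {J : Type*} [Fintype J] (x : J → P) :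
    ‖∑ e, x e‖ ^ 2 = (∑ e, ∑ f, ⟪x e, x f⟫_ℂ).re := by
  rw [← inner_self_eq_norm_sq (𝕜 := ℂ), sum_inner]
  simp_rw [inner_sum]
  rfl

theorem re_sum_inner_swap_le {J : Type*} [Fintype J] (t : J → J → P) :
    (∑ e, ∑ f, ⟪t e f, t f e⟫_ℂ).re ≤ ∑ e, ∑ f, ‖t e f‖ ^ 2 := by
  have h1 : (∑ e, ∑ f, ⟪t e f, t f e⟫_ℂ).re
      ≤ ∑ e, ∑ f, (‖t e f‖ ^ 2 + ‖t f e‖ ^ 2) / 2 := by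
    simp only [Complex.re_sum]
    refine Finset.sum_le_sum fun e _ => Finset.sum_le_sum fun f _ => ?_
    refine (Complex.re_le_norm _).trans ((norm_inner_le_norm _ _).trans ?_)
    nlinarith [sq_nonneg (‖t e f‖ - ‖t f e‖)]
  refine h1.trans (le_of_eq ?_)
  simp only [← Finset.sum_div, Finset.sum_add_distrib]
  rw [Finset.sum_comm (f := fun e f => ‖t f e‖ ^ 2)]
  ring

variable [Fintype ι]

/-- The number operator is bounded by `D` on elements of degree at most `D`. -/
theorem IsCCR.sum_norm_sq_ann_le (h : IsCCR a c V) (D : ℕ) :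
    ∀ p ∈ V D, ∑ i, ‖a i p‖ ^ 2 ≤ D * ‖p‖ ^ 2 := by
  induction D with
  | zero =>
    intro p hp
    simp [h.ann_zero _ p hp]
  | succ D ih =>
    intro p hp
    set S := ∑ i, ‖a i p‖ ^ 2 with hS
    set q := ∑ i, c i (a i p) with hq
    have hS0 : 0 ≤ S := Finset.sum_nonneg fun i _ => by positivity
    have h1 : (S : ℂ) = ⟪p, q⟫_ℂ := by
      rw [hq, inner_sum, hS]
      push_cast
      refine Finset.sum_congr rfl fun i _ => ?_
      rw [← h.adjoint, inner_self_eq_norm_sq_to_K]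
      rfl
    have h2 : ((‖q‖ ^ 2 : ℝ) : ℂ) =
        ((S + ∑ i, ∑ j, ‖a j (a i p)‖ ^ 2 : ℝ) : ℂ) := by
      have e1 : ((‖q‖ ^ 2 : ℝ) : ℂ) = ⟪q, q⟫_ℂ := by
        rw [inner_self_eq_norm_sq_to_K]; simp
      rw [e1]
      conv_lhs => rw [hq]
      rw [sum_inner]
      simp_rw [inner_sum, h.adjoint', h.comm, inner_add_right, ← h.adjoint,
        Finset.sum_add_distrib, h.ann_comm]
      rw [add_comm]
      push_cast
      congr 1
      · rw [hS]
        push_cast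
        refine Finset.sum_congr rfl fun i _ => ?_
        rw [Finset.sum_eq_single i]
        · rw [if_pos rfl, inner_self_eq_norm_sq_to_K]; rfl
        · intro j _ hj
          rw [if_neg (Ne.symm hj), inner_zero_right]
        · simp
      · refine Finset.sum_congr rfl fun i _ => Finset.sum_congr rfl fun j _ => ?_
        rw [h.ann_comm i j, inner_self_eq_norm_sq_to_K]; rfl
    have h2' : ‖q‖ ^ 2 = S + ∑ i, ∑ j, ‖a j (a i p)‖ ^ 2 := by exact_mod_cast h2
    have h3 : ∑ i, ∑ j, ‖a j (a i p)‖ ^ 2 ≤ D * S := by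
      rw [hS, Finset.mul_sum]
      exact Finset.sum_le_sum fun i _ => ih _ (h.ann_mem i D p hp)
    have h4 : S ≤ ‖p‖ * ‖q‖ := by
      have := norm_inner_le_norm (𝕜 := ℂ) p q
      rw [← h1] at this
      simpa [abs_of_nonneg hS0] using this
    have h5 : S ^ 2 ≤ ‖p‖ ^ 2 * ((D + 1) * S) := by
      calc S ^ 2 ≤ (‖p‖ * ‖q‖) ^ 2 := by gcongr
        _ = ‖p‖ ^ 2 * ‖q‖ ^ 2 := by ring
        _ ≤ _ := by gcongr; linarith
    rcases hS0.eq_or_lt with h0 | h0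
    · rw [← h0]; positivity
    · push_cast
      nlinarith

/-- The linear combination `∑ v i • a i` of a family of operators. -/
def opComb (a : ι → P →ₗ[ℂ] P) (v : ι → ℂ) : P →ₗ[ℂ] P := ∑ i, v i • a i

theorem opComb_apply (a : ι → P →ₗ[ℂ] P) (v : ι → ℂ) (p : P) :
    opComb a v p = ∑ i, v i • a i p := by
  simp [opComb, LinearMap.sum_apply]

theorem IsCCR.inner_cre (h : IsCCR a c V) (v : ι → ℂ) (p q : P) :
    ⟪opComb c v p, q⟫_ℂ = ⟪p, opComb a (fun i => conj (v i)) q⟫_ℂ := by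
  simp only [opComb_apply, sum_inner, inner_sum, inner_smul_left, inner_smul_right, h.adjoint']

theorem IsCCR.inner_ann (h : IsCCR a c V) (v : ι → ℂ) (p q : P) :
    ⟪opComb a v p, q⟫_ℂ = ⟪p, opComb c (fun i => conj (v i)) q⟫_ℂ := by
  simp only [opComb_apply, sum_inner, inner_sum, inner_smul_left, inner_smul_right, h.adjoint]

theorem IsCCR.ann_cre (h : IsCCR a c V) (v w : ι → ℂ) (p : P) :
    opComb a v (opComb c w p) = opComb c w (opComb a v p) + (∑ i, v i * w i) • p := by
  simp only [opComb_apply, map_sum, map_smul, h.comm, smul_add, Finset.sum_add_distrib,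
    Finset.smul_sum, Finset.sum_smul]
  congr 1
  · rw [Finset.sum_comm]
    refine Finset.sum_congr rfl fun i _ => Finset.sum_congr rfl fun j _ => ?_
    rw [smul_comm]
  · refine Finset.sum_congr rfl fun i _ => ?_
    rw [Finset.sum_eq_single i]
    · simp [smul_smul, mul_comm]
    · intro j _ hj; simp [hj]
    · simp

theorem IsCCR.ann_comb_mem (h : IsCCR a c V) (v : ι → ℂ) {D : ℕ} {p : P} (hp : p ∈ V D) :
    opComb a v p ∈ V D := by
  rw [opComb_apply]
  exact Submodule.sum_mem _ fun i _ => Submodule.smul_mem _ _ (h.ann_mem_self i hp)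

theorem IsCCR.cre_comb_mem (h : IsCCR a c V) (v : ι → ℂ) {D : ℕ} {p : P} (hp : p ∈ V D) :
    opComb c v p ∈ V (D + 1) := by
  rw [opComb_apply]
  exact Submodule.sum_mem _ fun i _ => Submodule.smul_mem _ _ (h.cre_mem i D p hp)

section Gram

variable {E : Type*}

/-- The Gram matrix of `b` is supported on the graph of `σ` and the diagonal, with entries
bounded by `s`. -/
structure SparseGram (σ : E → E) (s : ℝ) (b : E → ι → ℂ) : Prop where
  nonneg : 0 ≤ s
  le : ∀ e f, ‖∑ i, conj (b e i) * b f i‖ ≤ s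
  zero : ∀ e f, f ≠ e → f ≠ σ e → ∑ i, conj (b e i) * b f i = 0

variable {σ : E → E} {s : ℝ} {b : E → ι → ℂ}

theorem SparseGram.conj (hb : SparseGram σ s b) :
    SparseGram σ s (fun e i => conj (b e i)) := by
  have key : ∀ e f, ∑ i, conj (conj (b e i)) * conj (b f i)
      = conj (∑ i, conj (b e i) * b f i) := by intro e f; simp [map_sum]
  refine ⟨hb.nonneg, fun e f => ?_, fun e f h1 h2 => ?_⟩
  · rw [key, RCLike.norm_conj]; exact hb.le e f
  · rw [key, hb.zero e f h1 h2, map_zero]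

variable [Fintype E]

theorem SparseGram.re_sum_le (hb : SparseGram σ s b) (hσ : Function.Involutive σ)
    (T : E → P) :
    (∑ e, ∑ f, (∑ i, conj (b e i) * b f i) * ⟪T e, T f⟫_ℂ).re ≤ 2 * s * ∑ e, ‖T e‖ ^ 2 := by
  have hs := hb.nonneg
  have h1 : ∀ e, ‖∑ f, (∑ i, conj (b e i) * b f i) * ⟪T e, T f⟫_ℂ‖
      ≤ s * ‖T e‖ ^ 2 + s * ((‖T e‖ ^ 2 + ‖T (σ e)‖ ^ 2) / 2) := by
    intro e
    have hterm : ∀ f, ‖(∑ i, conj (b e i) * b f i) * ⟪T e, T f⟫_ℂ‖ ≤ s * (‖T e‖ * ‖T f‖) := by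
      intro f
      rw [norm_mul]
      exact mul_le_mul (hb.le e f) (norm_inner_le_norm _ _) (norm_nonneg _) hs
    have hsub : ∑ f, (∑ i, conj (b e i) * b f i) * ⟪T e, T f⟫_ℂ
        = ∑ f ∈ ({e, σ e} : Finset E), (∑ i, conj (b e i) * b f i) * ⟪T e, T f⟫_ℂ := by
      symm
      apply Finset.sum_subset (Finset.subset_univ _)
      intro f _ hf
      simp only [Finset.mem_insert, Finset.mem_singleton, not_or] at hf
      rw [hb.zero e f hf.1 hf.2, zero_mul]
    rw [hsub]
    calc _ ≤ ∑ f ∈ ({e, σ e} : Finset E), s * (‖T e‖ * ‖T f‖) :=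
          norm_sum_le_of_le _ fun f _ => hterm f
      _ ≤ s * (‖T e‖ * ‖T e‖) + s * (‖T e‖ * ‖T (σ e)‖) := by
          by_cases he : e = σ e
          · rw [← he]
            simp only [Finset.pair_eq_singleton, Finset.sum_singleton]
            have : 0 ≤ s * (‖T e‖ * ‖T e‖) := by positivity
            linarith
          · rw [Finset.sum_pair he]
      _ ≤ _ := by
          have : ‖T e‖ * ‖T (σ e)‖ ≤ (‖T e‖ ^ 2 + ‖T (σ e)‖ ^ 2) / 2 := by
            nlinarith [sq_nonneg (‖T e‖ - ‖T (σ e)‖)]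
          have := mul_le_mul_of_nonneg_left this hs
          nlinarith
  have h2 : ∑ e, ‖T (σ e)‖ ^ 2 = ∑ e, ‖T e‖ ^ 2 :=
    (Equiv.sum_comp (hσ.toPerm σ) fun e => ‖T e‖ ^ 2)
  calc _ ≤ ‖∑ e, ∑ f, (∑ i, conj (b e i) * b f i) * ⟪T e, T f⟫_ℂ‖ := Complex.re_le_norm _
    _ ≤ ∑ e, (s * ‖T e‖ ^ 2 + s * ((‖T e‖ ^ 2 + ‖T (σ e)‖ ^ 2) / 2)) :=
        norm_sum_le_of_le _ fun e _ => h1 e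
    _ = _ := by
        rw [Finset.sum_add_distrib, ← Finset.mul_sum, ← Finset.mul_sum, ← Finset.sum_div,
          Finset.sum_add_distrib, h2]
        ring

theorem SparseGram.sum_norm_sq_le (hb : SparseGram σ s b) (hσ : Function.Involutive σ)
    (u : ι → P) :
    ∑ e, ‖∑ i, b e i • u i‖ ^ 2 ≤ 2 * s * ∑ i, ‖u i‖ ^ 2 := by
  set T : E → P := fun e => ∑ i, b e i • u i with hT
  set W : ι → P := fun i => ∑ e, conj (b e i) • T e with hW
  set S := ∑ e, ‖T e‖ ^ 2 with hS
  set R := ∑ i, ‖u i‖ ^ 2 with hR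
  have hS0 : 0 ≤ S := Finset.sum_nonneg fun i _ => by positivity
  have hR0 : 0 ≤ R := Finset.sum_nonneg fun i _ => by positivity
  have hs := hb.nonneg
  have h1 : (S : ℂ) = ∑ i, ⟪W i, u i⟫_ℂ := by
    have : (S : ℂ) = ∑ e, ⟪T e, ∑ i, b e i • u i⟫_ℂ := by
      rw [hS]; push_cast
      refine Finset.sum_congr rfl fun e _ => ?_
      change _ = ⟪T e, T e⟫_ℂ
      rw [inner_self_eq_norm_sq_to_K]; rfl
    rw [this]
    simp only [hW, inner_sum, sum_inner, inner_smul_left, inner_smul_right, RCLike.conj_conj]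
    rw [Finset.sum_comm]
  have h2 : ∑ i, ‖W i‖ ^ 2 ≤ 2 * s * S := by
    have : ∑ i, ‖W i‖ ^ 2
        = (∑ e, ∑ f, (∑ i, conj ((fun e i => conj (b e i)) e i) * (fun e i => conj (b e i)) f i)
          * ⟪T e, T f⟫_ℂ).re := by
      simp only [hW, norm_sq_sum_eq_re]
      rw [← Complex.re_sum, Finset.sum_comm]
      congr 1
      refine Finset.sum_congr rfl fun e _ => ?_
      rw [Finset.sum_comm]
      refine Finset.sum_congr rfl fun f _ => ?_
      rw [Finset.sum_mul]
      refine Finset.sum_congr rfl fun i _ => ?_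
      rw [inner_smul_left, inner_smul_right, mul_assoc]
    rw [this]
    exact hb.conj.re_sum_le hσ T
  have h3 : S ^ 2 ≤ (∑ i, ‖W i‖ ^ 2) * R := by
    have : S ≤ ∑ i, ‖W i‖ * ‖u i‖ := by
      calc S = ‖(S : ℂ)‖ := by simp [abs_of_nonneg hS0]
        _ ≤ _ := by rw [h1]; exact norm_sum_le_of_le _ fun i _ => norm_inner_le_norm _ _
    calc S ^ 2 ≤ (∑ i, ‖W i‖ * ‖u i‖) ^ 2 := by gcongr
      _ ≤ _ := Finset.sum_mul_sq_le_sq_mul_sq _ _ _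
  have h4 : S ^ 2 ≤ 2 * s * S * R := h3.trans (by gcongr)
  rcases hS0.eq_or_lt with h0 | h0
  · rw [← h0]; positivity
  · nlinarith

theorem IsCCR.sum_norm_sq_ann_comb_le (h : IsCCR a c V) (hb : SparseGram σ s b)
    (hσ : Function.Involutive σ) {D : ℕ} {p : P} (hp : p ∈ V D) :
    ∑ e, ‖opComb a (b e) p‖ ^ 2 ≤ 2 * s * D * ‖p‖ ^ 2 := by
  simp only [opComb_apply]
  have hs := hb.nonneg
  refine (hb.sum_norm_sq_le hσ _).trans ?_
  rw [mul_assoc (2 * s)]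
  exact mul_le_mul_of_nonneg_left (h.sum_norm_sq_ann_le D p hp) (by positivity)

theorem IsCCR.norm_sq_sum_cre_le (h : IsCCR a c V) (b : E → ι → ℂ) (Φ : E → P) :
    ‖∑ e, opComb c (b e) (Φ e)‖ ^ 2 ≤
      (∑ e, ∑ f, (∑ i, conj (b e i) * b f i) * ⟪Φ e, Φ f⟫_ℂ).re
        + ∑ e, ∑ f, ‖opComb a (fun i => conj (b f i)) (Φ e)‖ ^ 2 := by
  rw [norm_sq_sum_eq_re]
  have key : ∀ e f, ⟪opComb c (b e) (Φ e), opComb c (b f) (Φ f)⟫_ℂ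
      = (∑ i, conj (b e i) * b f i) * ⟪Φ e, Φ f⟫_ℂ
        + ⟪opComb a (fun i => conj (b f i)) (Φ e), opComb a (fun i => conj (b e i)) (Φ f)⟫_ℂ := by
    intro e f
    rw [h.inner_cre, h.ann_cre, inner_add_right, inner_smul_right, h.inner_ann, add_comm]
    simp
  simp only [key, Finset.sum_add_distrib, Complex.add_re]
  gcongr
  exact re_sum_inner_swap_le fun e f => opComb a (fun i => conj (b f i)) (Φ e)

end Gram

end CCR

section BandOperators

open scoped InnerProductSpace ComplexConjugate

variable {ι κ P : Type*} [Fintype ι] [Fintype κ] [SeminormedAddCommGroup P]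

/-- The `ℓ²` norm of a finite family of vectors. -/
def l2norm (ψ : κ → P) : ℝ := ‖(WithLp.toLp 2 ψ : PiLp 2 fun _ : κ => P)‖

theorem l2norm_sq (ψ : κ → P) : l2norm ψ ^ 2 = ∑ x, ‖ψ x‖ ^ 2 :=
  PiLp.norm_sq_eq_of_L2 _ _

theorem l2norm_nonneg (ψ : κ → P) : 0 ≤ l2norm ψ := norm_nonneg _

theorem l2norm_add_le (ψ φ : κ → P) : l2norm (ψ + φ) ≤ l2norm ψ + l2norm φ :=
  norm_add_le (WithLp.toLp 2 ψ : PiLp 2 fun _ : κ => P) _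

variable [InnerProductSpace ℂ P] {a c : ι → P →ₗ[ℂ] P} {V : ℕ → Submodule ℂ P}
  {b : κ → κ → ι → ℂ} {s : ℝ}

/-- Second-moment conditions on the coefficients of a band matrix, up to correlations. -/
structure BandCoeff (s : ℝ) (b : κ → κ → ι → ℂ) : Prop where
  gram : SparseGram (Prod.swap : κ × κ → κ × κ) s (fun e => b e.1 e.2)
  row : ∀ x, ∑ z, ∑ i, ‖b x z i‖ ^ 2 ≤ 1
  col : ∀ z, ∑ x, ∑ i, ‖b x z i‖ ^ 2 ≤ 1

theorem BandCoeff.adjoint (hb : BandCoeff s b) :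
    BandCoeff s (fun x z i => conj (b z x i)) where
  gram := by
    have h := hb.gram.conj
    refine ⟨h.nonneg, fun e f => h.le e.swap f.swap, fun e f h1 h2 => ?_⟩
    refine h.zero e.swap f.swap (fun h3 => h1 (Prod.swap_injective h3)) (fun h3 => h2 ?_)
    exact Prod.swap_injective h3
  row x := by simpa using hb.col x
  col x := by simpa using hb.row x

/-- The operator-valued matrix with entries `∑ i, b x z i • a i`, acting on families. -/
def opMat (a : ι → P →ₗ[ℂ] P) (b : κ → κ → ι → ℂ) : (κ → P) →ₗ[ℂ] (κ → P) :=
  LinearMap.pi fun x => ∑ z, opComb a (b x z) ∘ₗ LinearMap.proj z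

theorem opMat_apply (a : ι → P →ₗ[ℂ] P) (b : κ → κ → ι → ℂ) (ψ : κ → P) (x : κ) :
    opMat a b ψ x = ∑ z, opComb a (b x z) (ψ z) := by
  simp [opMat, LinearMap.sum_apply]

theorem IsCCR.opMat_ann_mem (h : IsCCR a c V) (b : κ → κ → ι → ℂ) {D : ℕ} {ψ : κ → P}
    (hψ : ∀ x, ψ x ∈ V D) (x : κ) : opMat a b ψ x ∈ V D := by
  rw [opMat_apply]
  exact Submodule.sum_mem _ fun z _ => h.ann_comb_mem _ (hψ z)

theorem IsCCR.opMat_cre_mem (h : IsCCR a c V) (b : κ → κ → ι → ℂ) {D : ℕ} {ψ : κ → P}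
    (hψ : ∀ x, ψ x ∈ V D) (x : κ) : opMat c b ψ x ∈ V (D + 1) := by
  rw [opMat_apply]
  exact Submodule.sum_mem _ fun z _ => h.cre_comb_mem _ (hψ z)

theorem le_of_sq_le_sq_of_nonneg {A B : ℝ} (h : A ^ 2 ≤ B ^ 2) (hB : 0 ≤ B) : A ≤ B :=
  le_of_abs_le ((sq_le_sq.mp h).trans_eq (abs_of_nonneg hB))

theorem le_one_add_mul_of_sq_le {A B t : ℝ} (hB : 0 ≤ B) (ht : 0 ≤ t)
    (h : A ^ 2 ≤ (1 + 2 * t) * B ^ 2) : A ≤ (1 + t) * B := by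
  refine le_of_sq_le_sq_of_nonneg ?_ (by positivity)
  nlinarith [mul_nonneg (sq_nonneg t) (sq_nonneg B)]

theorem IsCCR.l2norm_cre_le (h : IsCCR a c V) (hb : BandCoeff s b) {D : ℕ} {ψ : κ → P}
    (hψ : ∀ x, ψ x ∈ V D) : l2norm (opMat c b ψ) ≤ (1 + D * s) * l2norm ψ := by
  have hs := hb.gram.nonneg
  apply le_one_add_mul_of_sq_le (l2norm_nonneg _) (by positivity)
  rw [l2norm_sq, l2norm_sq]
  have h1 : ∀ x, ‖opMat c b ψ x‖ ^ 2 ≤ ∑ z, (∑ i, ‖b x z i‖ ^ 2) * ‖ψ z‖ ^ 2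
      + ∑ z, ∑ w, ‖opComb a (fun i => conj (b x w i)) (ψ z)‖ ^ 2 := by
    intro x
    rw [opMat_apply]
    refine (h.norm_sq_sum_cre_le (fun z => b x z) ψ).trans ?_
    gcongr
    rw [Complex.re_sum]
    refine Finset.sum_le_sum fun z _ => le_of_eq ?_
    rw [Finset.sum_eq_single z]
    · have : ∑ i, conj (b x z i) * b x z i = ((∑ i, ‖b x z i‖ ^ 2 : ℝ) : ℂ) := by
        push_cast
        exact Finset.sum_congr rfl fun i _ => Complex.conj_mul' _
      rw [this, Complex.re_ofReal_mul, ← inner_self_eq_norm_sq (𝕜 := ℂ) (ψ z)]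
      rfl
    · intro w _ hw
      rw [hb.gram.zero (x, z) (x, w) (by simpa using hw), zero_mul]
      simp only [Prod.swap_prod_mk, ne_eq, Prod.mk.injEq, not_and]
      intro h1 h2
      exact hw (h2.trans h1)
    · simp
  calc _ ≤ ∑ x, (∑ z, (∑ i, ‖b x z i‖ ^ 2) * ‖ψ z‖ ^ 2
      + ∑ z, ∑ w, ‖opComb a (fun i => conj (b x w i)) (ψ z)‖ ^ 2) :=
        Finset.sum_le_sum fun x _ => h1 x
    _ = ∑ z, (∑ x, ∑ i, ‖b x z i‖ ^ 2) * ‖ψ z‖ ^ 2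
      + ∑ z, ∑ e : κ × κ, ‖opComb a (fun i => conj (b e.1 e.2 i)) (ψ z)‖ ^ 2 := by
        rw [Finset.sum_add_distrib, Finset.sum_comm,
          Finset.sum_comm (f := fun x z => ∑ w, ‖opComb a (fun i => conj (b x w i)) (ψ z)‖ ^ 2)]
        simp only [Finset.sum_mul, Fintype.sum_prod_type]
    _ ≤ ∑ z, 1 * ‖ψ z‖ ^ 2 + ∑ z, 2 * s * D * ‖ψ z‖ ^ 2 := by
        gcongr with z _ z _
        · exact hb.col z
        · exact h.sum_norm_sq_ann_comb_le hb.gram.conj Prod.swap_swap (hψ z)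
    _ = _ := by
        rw [← Finset.mul_sum, ← Finset.mul_sum]; ring

theorem IsCCR.l2norm_ann_le (h : IsCCR a c V) (hb : BandCoeff s b) {D : ℕ} {ψ : κ → P}
    (hψ : ∀ x, ψ x ∈ V D) : l2norm (opMat a b ψ) ≤ (1 + D * s) * l2norm ψ := by
  have hs := hb.gram.nonneg
  set φ := opMat a b ψ with hφ
  set χ := opMat c (fun x z i => conj (b z x i)) φ with hχ
  have hle : l2norm χ ≤ (1 + D * s) * l2norm φ :=
    h.l2norm_cre_le hb.adjoint (h.opMat_ann_mem b hψ)
  have h1 : ((l2norm φ ^ 2 : ℝ) : ℂ) = ∑ z, ⟪χ z, ψ z⟫_ℂ := by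
    have e1 : ((l2norm φ ^ 2 : ℝ) : ℂ) = ∑ x, ⟪φ x, opMat a b ψ x⟫_ℂ := by
      rw [l2norm_sq]
      push_cast
      refine Finset.sum_congr rfl fun x _ => ?_
      rw [← hφ, inner_self_eq_norm_sq_to_K]; rfl
    rw [e1]
    simp only [opMat_apply, inner_sum, hχ, sum_inner, h.inner_cre, RCLike.conj_conj]
    rw [Finset.sum_comm]
  have h2 : l2norm φ ^ 2 ≤ l2norm χ * l2norm ψ := by
    have e2 : l2norm φ ^ 2 ≤ ∑ z, ‖χ z‖ * ‖ψ z‖ := by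
      calc l2norm φ ^ 2 = ‖((l2norm φ ^ 2 : ℝ) : ℂ)‖ := by
            rw [Complex.norm_real, Real.norm_of_nonneg (by positivity)]
        _ ≤ _ := by rw [h1]; exact norm_sum_le_of_le _ fun i _ => norm_inner_le_norm _ _
    refine e2.trans ?_
    refine le_of_sq_le_sq_of_nonneg ?_ (mul_nonneg (l2norm_nonneg _) (l2norm_nonneg _))
    rw [mul_pow, l2norm_sq, l2norm_sq]
    exact Finset.sum_mul_sq_le_sq_mul_sq _ _ _
  have hψ0 := l2norm_nonneg ψ
  have h3 : l2norm φ ^ 2 ≤ (1 + D * s) * l2norm φ * l2norm ψ :=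
    h2.trans (by gcongr)
  rcases (l2norm_nonneg φ).eq_or_lt with h0 | h0
  · rw [← h0]; positivity
  · nlinarith

theorem IsCCR.l2norm_ann_cre_sub_le (h : IsCCR a c V) (hb : BandCoeff s b) {ρ : ℂ}
    (hzero : ∀ x z w, w ≠ x → ∑ i, b x z i * b z w i = 0)
    (hcov : ∀ x, ‖(∑ z, ∑ i, b x z i * b z x i) - ρ‖ ≤ 2 * s)
    {D : ℕ} {ψ : κ → P} (hψ : ∀ x, ψ x ∈ V D) :
    l2norm (opMat a b (opMat c b ψ) - ρ • ψ) ≤ (2 * D + 4) * s * l2norm ψ := by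
  have hs := hb.gram.nonneg
  set Θ : κ → P := fun x => ∑ e : κ × κ, opComb c (b e.1 e.2) (opComb a (b x e.1) (ψ e.2))
    with hΘ
  set Δ : κ → P := fun x => ((∑ z, ∑ i, b x z i * b z x i) - ρ) • ψ x with hΔ
  have hsplit : opMat a b (opMat c b ψ) - ρ • ψ = Δ + Θ := by
    funext x
    simp only [Pi.sub_apply, Pi.smul_apply, Pi.add_apply, hΔ, hΘ, opMat_apply, map_sum,
      h.ann_cre, Finset.sum_add_distrib, Fintype.sum_prod_type, sub_smul, Finset.sum_smul]
    have : ∀ z, ∑ w, ∑ i, (b x z i * b z w i) • ψ w = ∑ i, (b x z i * b z x i) • ψ x := by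
      intro z
      simp only [← Finset.sum_smul]
      rw [Finset.sum_eq_single x]
      · intro w _ hw; rw [hzero x z w hw, zero_smul]
      · simp
    rw [Finset.sum_congr rfl fun z _ => this z]
    abel
  have hΔle : l2norm Δ ≤ 2 * s * l2norm ψ := by
    refine le_of_sq_le_sq_of_nonneg ?_ (mul_nonneg (by positivity) (l2norm_nonneg _))
    rw [mul_pow, l2norm_sq, l2norm_sq, Finset.mul_sum]
    refine Finset.sum_le_sum fun x _ => ?_
    rw [hΔ, norm_smul, mul_pow]
    gcongr
    exact hcov x
  have hΘle : l2norm Θ ≤ 2 * (D + 1) * s * l2norm ψ := by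
    refine le_of_sq_le_sq_of_nonneg ?_ (mul_nonneg (by positivity) (l2norm_nonneg _))
    have h1 : ∀ x, ‖Θ x‖ ^ 2 ≤ 2 * s * (D + 1) * ∑ w, ∑ z, ‖opComb a (b x z) (ψ w)‖ ^ 2 := by
      intro x
      set Φ : κ × κ → P := fun e => opComb a (b x e.1) (ψ e.2) with hΦ
      have h2 := h.norm_sq_sum_cre_le (fun e : κ × κ => b e.1 e.2) Φ
      have h3 := hb.gram.re_sum_le Prod.swap_swap Φ
      have h4 : ∑ e, ∑ f : κ × κ, ‖opComb a (fun i => conj (b f.1 f.2 i)) (Φ e)‖ ^ 2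
          ≤ ∑ e, 2 * s * D * ‖Φ e‖ ^ 2 := by
        refine Finset.sum_le_sum fun e _ => ?_
        exact h.sum_norm_sq_ann_comb_le hb.gram.conj Prod.swap_swap
          (h.ann_comb_mem _ (hψ _))
      rw [← Finset.mul_sum] at h4
      have h5 : ∑ e, ‖Φ e‖ ^ 2 = ∑ w, ∑ z, ‖opComb a (b x z) (ψ w)‖ ^ 2 := by
        rw [Fintype.sum_prod_type, Finset.sum_comm]
      rw [← h5]
      linarith
    have h6 : ∑ x, ∑ w, ∑ z, ‖opComb a (b x z) (ψ w)‖ ^ 2 ≤ 2 * s * D * l2norm ψ ^ 2 := by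
      rw [Finset.sum_comm, l2norm_sq, Finset.mul_sum]
      refine Finset.sum_le_sum fun w _ => ?_
      have := h.sum_norm_sq_ann_comb_le hb.gram Prod.swap_swap (hψ w)
      rwa [Fintype.sum_prod_type] at this
    rw [l2norm_sq]
    calc ∑ x, ‖Θ x‖ ^ 2
        ≤ ∑ x, 2 * s * (D + 1) * ∑ w, ∑ z, ‖opComb a (b x z) (ψ w)‖ ^ 2 :=
          Finset.sum_le_sum fun x _ => h1 x
      _ ≤ 2 * s * (D + 1) * (2 * s * D * l2norm ψ ^ 2) := by
          rw [← Finset.mul_sum]; gcongr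
      _ ≤ 2 * s * (D + 1) * (2 * s * (D + 1) * l2norm ψ ^ 2) := by
          gcongr; linarith
      _ = _ := by ring
  rw [hsplit]
  refine (l2norm_add_le _ _).trans ?_
  linarith

/-- The rescaled Chebyshev polynomials of the second kind, evaluated at `M`. -/
def chebU {R : Type*} [Ring R] [Algebra ℂ R] (ρ : ℂ) (M : R) : ℕ → R
  | 0 => 1
  | 1 => M
  | m + 2 => chebU ρ M (m + 1) * M - ρ • chebU ρ M m

/-- The part of `chebU ρ (A + C) (m + 1)` whose words end with `C`. -/
def chebF {R : Type*} [Ring R] [Algebra ℂ R] (ρ : ℂ) (A C : R) : ℕ → R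
  | 0 => C
  | m + 1 => chebU ρ (A + C) (m + 1) * C - ρ • chebU ρ (A + C) m

theorem chebU_succ_eq {R : Type*} [Ring R] [Algebra ℂ R] (ρ : ℂ) (A C : R) (m : ℕ) :
    chebU ρ (A + C) (m + 1) = chebU ρ (A + C) m * A + chebF ρ A C m := by
  cases m with
  | zero => simp [chebU, chebF]
  | succ m => rw [chebU, chebF, mul_add]; abel

theorem chebF_succ_eq {R : Type*} [Ring R] [Algebra ℂ R] (ρ : ℂ) (A C : R) (m : ℕ) :
    chebF ρ A C (m + 1)
      = chebF ρ A C m * C + chebU ρ (A + C) m * (A * C - ρ • (1 : R)) := by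
  rw [chebF, chebU_succ_eq, mul_sub, add_mul, mul_assoc, mul_smul_comm, mul_one]
  abel

theorem IsCCR.l2norm_chebU_le (h : IsCCR a c V) (hb : BandCoeff s b) {ρ : ℂ}
    (hzero : ∀ x z w, w ≠ x → ∑ i, b x z i * b z w i = 0)
    (hcov : ∀ x, ‖(∑ z, ∑ i, b x z i * b z x i) - ρ‖ ≤ 2 * s)
    {k : ℕ} {τ : ℝ} (hτ : 1 + k * s + (2 * k + 4) * s * k ≤ τ) (m : ℕ) :
    ∀ D (ψ : κ → P), (∀ x, ψ x ∈ V D) →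
      (D + m ≤ k → l2norm (chebU (R := Module.End ℂ (κ → P)) ρ (opMat a b + opMat c b) m ψ)
        ≤ (m + 1) * τ ^ m * l2norm ψ) ∧
      (D + m + 1 ≤ k → l2norm (chebF (R := Module.End ℂ (κ → P)) ρ (opMat a b) (opMat c b) m ψ)
        ≤ τ ^ (m + 1) * l2norm ψ) := by
  have hs := hb.gram.nonneg
  have hkk : 0 ≤ (2 * k + 4) * s * k := by positivity
  have hks : 0 ≤ k * s := by positivity
  have hτ1 : 1 ≤ τ := by linarith
  have hτ0 : 0 ≤ τ := by linarith
  have hD : ∀ {D : ℕ}, D ≤ k → 1 + D * s ≤ τ := by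
    intro D hD
    have : (D : ℝ) * s ≤ k * s := by gcongr
    linarith
  induction m with
  | zero =>
    intro D ψ hψ
    refine ⟨fun _ => by simp [chebU], fun hk => ?_⟩
    have := h.l2norm_cre_le hb hψ
    simp only [chebF, zero_add, pow_one]
    exact this.trans (by gcongr; exacts [l2norm_nonneg _, hD (by omega)])
  | succ m ih =>
    intro D ψ hψ
    have hn := l2norm_nonneg ψ
    constructor
    · intro hk
      rw [chebU_succ_eq, LinearMap.add_apply, Module.End.mul_apply]
      refine (l2norm_add_le _ _).trans ?_
      have h1 := (ih D _ (h.opMat_ann_mem b hψ)).1 (by omega)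
      have h2 := (ih D ψ hψ).2 (by omega)
      have h3 := h.l2norm_ann_le hb hψ
      have h4 : l2norm (opMat a b ψ) ≤ τ * l2norm ψ :=
        h3.trans (by gcongr; exact hD (by omega))
      have h5 : (m + 1) * τ ^ m * l2norm (opMat a b ψ) ≤ (m + 1) * τ ^ m * (τ * l2norm ψ) := by
        gcongr
      push_cast
      calc _ ≤ (m + 1) * τ ^ m * (τ * l2norm ψ) + τ ^ (m + 1) * l2norm ψ :=
            add_le_add (h1.trans h5) h2
        _ = _ := by ring
    · intro hk
      rw [chebF_succ_eq, LinearMap.add_apply, Module.End.mul_apply, Module.End.mul_apply]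
      refine (l2norm_add_le _ _).trans ?_
      have e : (opMat a b * opMat c b - ρ • (1 : Module.End ℂ (κ → P))) ψ
          = opMat a b (opMat c b ψ) - ρ • ψ := rfl
      rw [e]
      have hmem : ∀ x, (opMat a b (opMat c b ψ) - ρ • ψ) x ∈ V (D + 1) := fun x =>
        Submodule.sub_mem _ (h.opMat_ann_mem b (h.opMat_cre_mem b hψ) x)
          (Submodule.smul_mem _ _ (h.mono (Nat.le_succ D) (hψ x)))
      have h1 := (ih (D + 1) _ (h.opMat_cre_mem b hψ)).2 (by omega)
      have h2 := (ih (D + 1) _ hmem).1 (by omega)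
      have h3 := h.l2norm_cre_le hb hψ
      have h4 := h.l2norm_ann_cre_sub_le hb hzero hcov hψ
      have hDk : (D : ℝ) ≤ k := by exact_mod_cast (by omega : D ≤ k)
      have hmk : (m : ℝ) + 1 ≤ k := by exact_mod_cast (by omega : m + 1 ≤ k)
      calc _ ≤ τ ^ (m + 1) * ((1 + D * s) * l2norm ψ)
            + (m + 1) * τ ^ m * ((2 * D + 4) * s * l2norm ψ) := by
            refine add_le_add (h1.trans ?_) (h2.trans ?_) <;> gcongr
        _ ≤ τ ^ (m + 1) * ((1 + k * s) * l2norm ψ)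
            + k * τ ^ (m + 1) * ((2 * k + 4) * s * l2norm ψ) := by
            gcongr
            any_goals first | exact hτ1 | omega
        _ = τ ^ (m + 1) * (1 + k * s + (2 * k + 4) * s * k) * l2norm ψ := by ring
        _ ≤ τ ^ (m + 1) * τ * l2norm ψ := by gcongr
        _ = _ := by ring

end BandOperators

section GaussianPolynomials

open scoped InnerProductSpace ComplexConjugate
open MvPolynomial (pderiv monomial restrictTotalDegree)

theorem integrable_pow_gaussianReal (k : ℕ) :
    Integrable (fun x : ℝ => x ^ k) (gaussianReal 0 1) := by
  have h := (memLp_id_gaussianReal' (μ := 0) (v := 1) (k : ℝ≥0∞) (by simp)).integrable_norm_pow'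
  refine h.mono' (by fun_prop) (ae_of_all _ fun x => ?_)
  simp

theorem integrable_pow_mul_gaussianPDFReal (k : ℕ) :
    Integrable (fun x : ℝ => x ^ k * gaussianPDFReal 0 1 x) := by
  have h := integrable_pow_gaussianReal k
  rw [gaussianReal_of_var_ne_zero _ one_ne_zero,
    integrable_withDensity_iff_integrable_smul' (measurable_gaussianPDF 0 1)
      (ae_of_all _ fun x => gaussianPDF_lt_top)] at h
  refine h.congr (ae_of_all _ fun x => ?_)
  simp [gaussianPDF, ENNReal.toReal_ofReal (gaussianPDFReal_nonneg 0 1 x), mul_comm]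

theorem integral_pow_succ_gaussianReal (k : ℕ) :
    ∫ x : ℝ, x ^ (k + 1) ∂(gaussianReal 0 1) = k * ∫ x : ℝ, x ^ (k - 1) ∂(gaussianReal 0 1) := by
  rw [integral_gaussianReal_eq_integral_smul one_ne_zero,
    integral_gaussianReal_eq_integral_smul one_ne_zero, ← integral_const_mul]
  have hd : ∀ x, HasDerivAt (fun x => - gaussianPDFReal 0 1 x) (x * gaussianPDFReal 0 1 x) x := by
    intro x
    have h1 : HasDerivAt (fun x : ℝ => -(x - 0) ^ 2 / (2 * ((1 : NNReal) : ℝ))) (-x) x := by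
      have := (((hasDerivAt_id x).sub_const 0).pow 2).neg.div_const (2 * ((1 : NNReal) : ℝ))
      refine this.congr_deriv ?_
      simp
      ring
    have h2 := (h1.exp.const_mul (√(2 * Real.pi * ((1 : NNReal) : ℝ)))⁻¹).neg
    refine h2.congr_deriv ?_
    rw [gaussianPDFReal]
    ring
  have key := integral_mul_deriv_eq_deriv_mul_of_integrable
    (u := fun x : ℝ => x ^ k) (u' := fun x => k * x ^ (k - 1))
    (v := fun x => - gaussianPDFReal 0 1 x) (v' := fun x => x * gaussianPDFReal 0 1 x)
    (fun x _ => hasDerivAt_pow k x) (fun x _ => hd x) ?_ ?_ ?_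
  · rw [← integral_neg] at key
    refine (integral_congr_ae (ae_of_all _ fun x => ?_)).trans
      (key.trans (integral_congr_ae (ae_of_all _ fun x => ?_)))
    · simp only [smul_eq_mul]; ring
    · simp only [smul_eq_mul]; ring
  · refine (integrable_pow_mul_gaussianPDFReal (k + 1)).congr (ae_of_all _ fun x => ?_)
    simp only [Pi.mul_apply]; ring
  · refine ((integrable_pow_mul_gaussianPDFReal (k - 1)).const_mul (-k : ℝ)).congr
      (ae_of_all _ fun x => ?_)
    simp only [Pi.mul_apply]; ring
  · refine ((integrable_pow_mul_gaussianPDFReal k).const_mul (-1 : ℝ)).congr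
      (ae_of_all _ fun x => ?_)
    simp only [Pi.mul_apply]; ring

theorem integrable_ofReal_pow_gaussianReal (k : ℕ) :
    Integrable (fun x : ℝ => (x : ℂ) ^ k) (gaussianReal 0 1) := by
  simpa using (integrable_pow_gaussianReal k).ofReal (𝕜 := ℂ)

theorem integral_ofReal_pow_succ_gaussianReal (k : ℕ) :
    ∫ x : ℝ, (x : ℂ) ^ (k + 1) ∂(gaussianReal 0 1)
      = k * ∫ x : ℝ, (x : ℂ) ^ (k - 1) ∂(gaussianReal 0 1) := by
  have h := congrArg (fun r : ℝ => (r : ℂ)) (integral_pow_succ_gaussianReal k)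
  simp only [Complex.ofReal_mul, Complex.ofReal_natCast] at h
  rw [← integral_complex_ofReal, ← integral_complex_ofReal] at h
  simpa using h

variable {ι : Type*}

/-- Evaluation of a complex polynomial at a real point. -/
def evalReal (x : ι → ℝ) : MvPolynomial ι ℂ →+* ℂ := MvPolynomial.eval fun i => (x i : ℂ)

theorem evalReal_map_conj (x : ι → ℝ) (p : MvPolynomial ι ℂ) :
    evalReal x (MvPolynomial.map (starRingEnd ℂ) p) = conj (evalReal x p) := by
  induction p using MvPolynomial.induction_on with
  | C z => simp [evalReal]
  | add p q hp hq => simp [hp, hq]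
  | mul_X p i hp => simp only [map_mul, hp]; simp [evalReal]

/-- Partial derivatives act as annihilation operators. -/
def polyAnn (i : ι) : MvPolynomial ι ℂ →ₗ[ℂ] MvPolynomial ι ℂ := (pderiv i).toLinearMap

/-- The creation operators `p ↦ X i * p - ∂ i p`. -/
def polyCre (i : ι) : MvPolynomial ι ℂ →ₗ[ℂ] MvPolynomial ι ℂ :=
  LinearMap.mulLeft ℂ (MvPolynomial.X i) - polyAnn i

theorem polyAnn_apply (i : ι) (p : MvPolynomial ι ℂ) : polyAnn i p = pderiv i p := rfl

theorem polyCre_apply (i : ι) (p : MvPolynomial ι ℂ) :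
    polyCre i p = MvPolynomial.X i * p - pderiv i p := rfl

theorem pderiv_pderiv_comm (i j : ι) (p : MvPolynomial ι ℂ) :
    pderiv i (pderiv j p) = pderiv j (pderiv i p) := by
  induction p using MvPolynomial.induction_on with
  | C z => simp
  | add p q hp hq => simp [hp, hq]
  | mul_X p k hp =>
    simp only [MvPolynomial.pderiv_mul, map_add, hp, MvPolynomial.pderiv_X]
    have h1 : ∀ l m, pderiv l (Pi.single (M := fun _ => MvPolynomial ι ℂ) m 1 k) = 0 := by
      intro l m
      by_cases h : k = m
      · subst h; simp
      · simp [Pi.single_eq_of_ne h]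
    simp only [h1]
    ring

theorem totalDegree_pderiv_le (i : ι) (p : MvPolynomial ι ℂ) :
    (pderiv i p).totalDegree ≤ p.totalDegree - 1 := by
  conv_lhs => rw [p.as_sum, map_sum]
  refine MvPolynomial.totalDegree_finsetSum_le fun m hm => ?_
  rw [MvPolynomial.pderiv_monomial]
  by_cases h0 : m i = 0
  · simp [h0]
  · have h1 := MvPolynomial.le_totalDegree hm
    have h2 : Finsupp.single i 1 ≤ m := by
      rw [Finsupp.single_le_iff]; omega
    have h3 : m = (m - Finsupp.single i 1) + Finsupp.single i 1 := (tsub_add_cancel_of_le h2).symm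
    have h4 : m.sum (fun _ e => e) = (m - Finsupp.single i 1).sum (fun _ e => e) + 1 := by
      conv_lhs => rw [h3]
      rw [Finsupp.sum_add_index' (by simp) (by simp)]
      simp
    refine (MvPolynomial.totalDegree_monomial_le _ _).trans ?_
    change (m - Finsupp.single i 1).sum (fun _ e => e) ≤ _
    omega

variable [Fintype ι]

/-- The standard Gaussian measure on `ι → ℝ`. -/
def stdGaussianPi (ι : Type*) [Fintype ι] : Measure (ι → ℝ) :=
  Measure.pi fun _ => gaussianReal 0 1

instance : IsProbabilityMeasure (stdGaussianPi ι) := by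
  unfold stdGaussianPi; infer_instance

theorem evalReal_monomial (x : ι → ℝ) (m : ι →₀ ℕ) (z : ℂ) :
    evalReal x (monomial m z) = z * ∏ i, (x i : ℂ) ^ m i := by
  rw [evalReal, MvPolynomial.eval_monomial, Finsupp.prod_fintype _ _ (by simp)]

theorem integrable_evalReal (p : MvPolynomial ι ℂ) :
    Integrable (fun x => evalReal x p) (stdGaussianPi ι) := by
  induction p using MvPolynomial.induction_on' with
  | monomial m z =>
    simp only [evalReal_monomial]
    refine Integrable.const_mul ?_ z
    exact Integrable.fintype_prod fun i => integrable_ofReal_pow_gaussianReal (m i)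
  | add p q hp hq =>
    simp only [map_add]
    exact hp.add hq

/-- The Gaussian expectation of a polynomial. -/
def gaussExp (p : MvPolynomial ι ℂ) : ℂ := ∫ x, evalReal x p ∂(stdGaussianPi ι)

theorem gaussExp_add (p q : MvPolynomial ι ℂ) : gaussExp (p + q) = gaussExp p + gaussExp q := by
  simp only [gaussExp, map_add]
  exact integral_add (integrable_evalReal p) (integrable_evalReal q)

theorem gaussExp_smul (z : ℂ) (p : MvPolynomial ι ℂ) : gaussExp (z • p) = z * gaussExp p := by
  simp only [gaussExp, MvPolynomial.smul_eq_C_mul, map_mul]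
  rw [← integral_const_mul]
  simp [evalReal]

theorem gaussExp_sub (p q : MvPolynomial ι ℂ) : gaussExp (p - q) = gaussExp p - gaussExp q := by
  simp only [gaussExp, map_sub]
  exact integral_sub (integrable_evalReal p) (integrable_evalReal q)

theorem gaussExp_monomial (m : ι →₀ ℕ) (z : ℂ) :
    gaussExp (monomial m z) = z * ∏ i, ∫ x : ℝ, (x : ℂ) ^ m i ∂(gaussianReal 0 1) := by
  simp only [gaussExp, evalReal_monomial]
  rw [integral_const_mul]
  congr 1
  exact integral_fintype_prod_eq_prod (fun i (x : ℝ) => (x : ℂ) ^ m i)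

/-- Gaussian integration by parts. -/
theorem gaussExp_X_mul (i : ι) (p : MvPolynomial ι ℂ) :
    gaussExp (MvPolynomial.X i * p) = gaussExp (pderiv i p) := by
  induction p using MvPolynomial.induction_on' with
  | monomial m z =>
    rw [MvPolynomial.pderiv_monomial, MvPolynomial.X, MvPolynomial.monomial_mul, one_mul,
      gaussExp_monomial, gaussExp_monomial, ← Finset.mul_prod_erase _ _ (Finset.mem_univ i),
      ← Finset.mul_prod_erase _ _ (Finset.mem_univ i)]
    have h1 : (Finsupp.single i 1 + m : ι →₀ ℕ) i = m i + 1 := by simp [add_comm]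
    have h2 : (m - Finsupp.single i 1 : ι →₀ ℕ) i = m i - 1 := by simp
    rw [h1, h2, integral_ofReal_pow_succ_gaussianReal]
    have h3 : ∏ j ∈ Finset.univ.erase i,
        ∫ x : ℝ, (x : ℂ) ^ (Finsupp.single i 1 + m : ι →₀ ℕ) j ∂(gaussianReal 0 1)
        = ∏ j ∈ Finset.univ.erase i,
        ∫ x : ℝ, (x : ℂ) ^ (m - Finsupp.single i 1 : ι →₀ ℕ) j ∂(gaussianReal 0 1) := by
      refine Finset.prod_congr rfl fun j hj => ?_
      have hne : i ≠ j := (Finset.ne_of_mem_erase hj).symm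
      simp [Finsupp.single_eq_of_ne' hne]
    rw [h3]
    ring
  | add p q hp hq => rw [mul_add, map_add, gaussExp_add, gaussExp_add, hp, hq]

theorem gaussExp_map_conj (p : MvPolynomial ι ℂ) :
    gaussExp (MvPolynomial.map (starRingEnd ℂ) p) = conj (gaussExp p) := by
  simp only [gaussExp, evalReal_map_conj]
  exact integral_conj

theorem gaussExp_conj_mul_self (p : MvPolynomial ι ℂ) :
    gaussExp (MvPolynomial.map (starRingEnd ℂ) p * p)
      = ((∫ x, ‖evalReal x p‖ ^ 2 ∂(stdGaussianPi ι) : ℝ) : ℂ) := by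
  rw [← integral_complex_ofReal, gaussExp]
  congr 1
  funext x
  rw [map_mul, evalReal_map_conj, Complex.conj_mul']
  push_cast
  rfl

/-- The Gaussian `L²` inner product on polynomials. -/
@[reducible]
def gaussCore (ι : Type*) [Fintype ι] : PreInnerProductSpace.Core ℂ (MvPolynomial ι ℂ) where
  inner p q := gaussExp (MvPolynomial.map (starRingEnd ℂ) p * q)
  conj_inner_symm p q := by
    rw [← gaussExp_map_conj, map_mul, MvPolynomial.map_map]
    simp [mul_comm, MvPolynomial.map_id]
  re_inner_nonneg p := by
    rw [gaussExp_conj_mul_self]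
    exact integral_nonneg fun x => by positivity
  add_left p q r := by rw [map_add, add_mul, gaussExp_add]
  smul_left p q z := by
    rw [← gaussExp_smul, MvPolynomial.smul_eq_C_mul, MvPolynomial.smul_eq_C_mul, map_mul,
      MvPolynomial.map_C, mul_assoc]

instance gaussSeminormed : SeminormedAddCommGroup (MvPolynomial ι ℂ) :=
  @InnerProductSpace.Core.toSeminormedAddCommGroup ℂ _ _ _ _ (gaussCore ι)

instance gaussInner : InnerProductSpace ℂ (MvPolynomial ι ℂ) :=
  InnerProductSpace.ofCore (gaussCore ι)

theorem gauss_inner_eq (p q : MvPolynomial ι ℂ) :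
    ⟪p, q⟫_ℂ = gaussExp (MvPolynomial.map (starRingEnd ℂ) p * q) := rfl

theorem gauss_norm_sq (p : MvPolynomial ι ℂ) :
    ‖p‖ ^ 2 = ∫ x, ‖evalReal x p‖ ^ 2 ∂(stdGaussianPi ι) := by
  rw [← inner_self_eq_norm_sq (𝕜 := ℂ), gauss_inner_eq, gaussExp_conj_mul_self]
  exact Complex.ofReal_re _

theorem isCCR_polynomial :
    IsCCR (polyAnn (ι := ι)) polyCre (restrictTotalDegree ι ℂ) where
  adjoint i p q := by
    rw [gauss_inner_eq, gauss_inner_eq, polyAnn_apply, polyCre_apply, ← MvPolynomial.pderiv_map,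
      mul_sub, gaussExp_sub, mul_left_comm, gaussExp_X_mul, MvPolynomial.pderiv_mul, gaussExp_add]
    ring
  comm i j p := by
    simp only [polyAnn_apply, polyCre_apply, map_sub, MvPolynomial.pderiv_mul,
      MvPolynomial.pderiv_X, pderiv_pderiv_comm i j]
    by_cases h : i = j
    · subst h; simp; ring
    · rw [if_neg h, Pi.single_eq_of_ne (Ne.symm h)]; ring
  ann_comm i j p := pderiv_pderiv_comm i j p
  ann_mem i D p hp := by
    rw [MvPolynomial.mem_restrictTotalDegree] at hp ⊢
    have := totalDegree_pderiv_le i p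
    rw [polyAnn_apply]
    omega
  ann_zero i p hp := by
    rw [MvPolynomial.mem_restrictTotalDegree, Nat.le_zero,
      MvPolynomial.totalDegree_eq_zero_iff_eq_C] at hp
    rw [polyAnn_apply, hp, MvPolynomial.pderiv_C]
  mono D D' h p hp := by
    rw [MvPolynomial.mem_restrictTotalDegree] at hp ⊢
    exact hp.trans h
  cre_mem i D p hp := by
    rw [MvPolynomial.mem_restrictTotalDegree] at hp ⊢
    have h1 := totalDegree_pderiv_le i p
    have h2 := MvPolynomial.totalDegree_mul (MvPolynomial.X i) p
    rw [MvPolynomial.totalDegree_X] at h2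
    rw [polyCre_apply]
    refine (MvPolynomial.totalDegree_sub _ _).trans (max_le ?_ ?_) <;> omega

variable {κ : Type*} [Fintype κ]

/-- The matrix with entries linear in `x`, with coefficients `b`. -/
def linMat (b : κ → κ → ι → ℂ) (x : ι → ℝ) : Matrix κ κ ℂ :=
  Matrix.of fun y z => ∑ i, (x i : ℂ) * b y z i

theorem evalReal_opMat (b : κ → κ → ι → ℂ) (x : ι → ℝ) (ψ : κ → MvPolynomial ι ℂ) :
    (fun y => evalReal x ((opMat polyAnn b + opMat polyCre b) ψ y))
      = linMat b x *ᵥ fun y => evalReal x (ψ y) := by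
  funext y
  simp only [LinearMap.add_apply, Pi.add_apply, opMat_apply, opComb_apply, Matrix.mulVec,
    dotProduct, linMat, Matrix.of_apply, ← Finset.sum_add_distrib, ← smul_add, polyAnn_apply,
    polyCre_apply, map_sum]
  refine Finset.sum_congr rfl fun z _ => ?_
  rw [Finset.sum_mul]
  refine Finset.sum_congr rfl fun i _ => ?_
  rw [add_sub_cancel, MvPolynomial.smul_eq_C_mul, map_mul, map_mul]
  simp [evalReal]
  ring

theorem evalReal_chebU [DecidableEq κ] (ρ : ℂ) (b : κ → κ → ι → ℂ) (x : ι → ℝ) (k : ℕ) :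
    ∀ ψ : κ → MvPolynomial ι ℂ,
      (fun y => evalReal x (chebU (R := Module.End ℂ (κ → MvPolynomial ι ℂ)) ρ
        (opMat polyAnn b + opMat polyCre b) k ψ y))
      = chebU ρ (linMat b x) k *ᵥ fun y => evalReal x (ψ y) := by
  induction k using Nat.twoStepInduction with
  | zero => intro ψ; simp [chebU]
  | one => intro ψ; exact evalReal_opMat b x ψ
  | more k h1 h2 =>
    intro ψ
    simp only [chebU, Matrix.sub_mulVec, Matrix.smul_mulVec, ← Matrix.mulVec_mulVec,
      ← evalReal_opMat, ← h1, ← h2]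
    funext y
    simp [MvPolynomial.smul_eq_C_mul, evalReal]

/-- Second moment bound for the Chebyshev polynomials of a Gaussian band matrix. -/
theorem integral_sum_norm_sq_chebU_le [DecidableEq κ] {b : κ → κ → ι → ℂ} {s : ℝ}
    (hb : BandCoeff s b) {ρ : ℂ}
    (hzero : ∀ x z w, w ≠ x → ∑ i, b x z i * b z w i = 0)
    (hcov : ∀ x, ‖(∑ z, ∑ i, b x z i * b z x i) - ρ‖ ≤ 2 * s)
    {k : ℕ} {τ : ℝ} (hτ : 1 + k * s + (2 * k + 4) * s * k ≤ τ) :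
    Integrable (fun x => ∑ z, ∑ y, ‖chebU ρ (linMat b x) k y z‖ ^ 2) (stdGaussianPi ι) ∧
    ∫ x, ∑ z, ∑ y, ‖chebU ρ (linMat b x) k y z‖ ^ 2 ∂(stdGaussianPi ι)
      ≤ Fintype.card κ * ((k + 1) * τ ^ k) ^ 2 := by
  set ψ : κ → κ → MvPolynomial ι ℂ := fun z => Pi.single z 1 with hψ
  set φ : κ → κ → MvPolynomial ι ℂ := fun z =>
    chebU (R := Module.End ℂ (κ → MvPolynomial ι ℂ)) ρ
        (opMat polyAnn b + opMat polyCre b) k (ψ z) with hφ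
  have hev : ∀ x y z, chebU ρ (linMat b x) k y z = evalReal x (φ z y) := by
    intro x y z
    have h1 := congrFun (evalReal_chebU ρ b x k (ψ z)) y
    have h2 : (fun y => evalReal x (ψ z y)) = Pi.single z 1 := by
      funext w
      by_cases h : w = z
      · subst h; simp [hψ]
      · simp [hψ, Pi.single_eq_of_ne h]
    rw [h2, Matrix.mulVec_single_one] at h1
    exact h1.symm
  have hInt : ∀ y z, Integrable (fun x => ‖evalReal x (φ z y)‖ ^ 2) (stdGaussianPi ι) := by
    intro y z
    have := (integrable_evalReal (MvPolynomial.map (starRingEnd ℂ) (φ z y) * φ z y)).norm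
    refine this.congr (ae_of_all _ fun x => ?_)
    simp only [map_mul, evalReal_map_conj, norm_mul, RCLike.norm_conj, sq]
  have hInt1 : ∀ z, Integrable (fun x => ∑ y, ‖evalReal x (φ z y)‖ ^ 2) (stdGaussianPi ι) :=
    fun z => integrable_finsetSum _ fun y _ => hInt y z
  simp only [hev]
  refine ⟨integrable_finsetSum _ fun z _ => hInt1 z, ?_⟩
  rw [integral_finsetSum _ fun z _ => hInt1 z]
  have hz : ∀ z, ∫ x, ∑ y, ‖evalReal x (φ z y)‖ ^ 2 ∂(stdGaussianPi ι)
      ≤ ((k + 1) * τ ^ k) ^ 2 := by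
    intro z
    rw [integral_finsetSum _ fun y _ => hInt y z]
    simp only [← gauss_norm_sq]
    rw [← l2norm_sq]
    have hmem : ∀ y, ψ z y ∈ restrictTotalDegree ι ℂ 0 := by
      intro y
      rw [MvPolynomial.mem_restrictTotalDegree]
      by_cases h : y = z
      · subst h; simp [hψ]
      · simp [hψ, Pi.single_eq_of_ne h]
    have hone : l2norm (ψ z) = 1 := by
      have : l2norm (ψ z) ^ 2 = 1 := by
        rw [l2norm_sq, Finset.sum_eq_single z]
        · simp [gauss_norm_sq, hψ]
        · intro y _ hy; simp [hψ, Pi.single_eq_of_ne hy]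
        · simp
      exact (pow_eq_one_iff_of_nonneg (l2norm_nonneg _) two_ne_zero).mp this
    have := ((isCCR_polynomial (ι := ι)).l2norm_chebU_le hb hzero hcov hτ k 0 (ψ z) hmem).1
      (by omega)
    rw [hone, mul_one] at this
    exact pow_le_pow_left₀ (l2norm_nonneg _) this 2
  calc _ ≤ ∑ z : κ, ((k + 1) * τ ^ k) ^ 2 := Finset.sum_le_sum fun z _ => hz z
    _ = _ := by simp

end GaussianPolynomials

section Eigenvalues

open scoped ComplexConjugate

theorem exists_mulVec_eq_smul_of_mem_eigs {N : ℕ} {M : Matrix (Fin N) (Fin N) ℂ} {z : ℂ}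
    (hz : z ∈ eigs M) : ∃ v : Fin N → ℂ, v ≠ 0 ∧ M *ᵥ v = z • v := by
  have h1 : M.charpoly.IsRoot z := (Polynomial.mem_roots'.mp hz).2
  rw [Polynomial.IsRoot, Matrix.eval_charpoly] at h1
  obtain ⟨v, hv, h2⟩ := Matrix.exists_mulVec_eq_zero_iff.mpr h1
  refine ⟨v, hv, ?_⟩
  rw [Matrix.sub_mulVec, sub_eq_zero, Matrix.scalar_apply, ← Matrix.smul_one_eq_diagonal,
    Matrix.smul_mulVec, Matrix.one_mulVec] at h2
  exact h2.symm

theorem chebU_mulVec_eq_smul {κ : Type*} [Fintype κ] [DecidableEq κ] (ρ : ℂ)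
    {M : Matrix κ κ ℂ} {z : ℂ}
    {v : κ → ℂ} (h : M *ᵥ v = z • v) (k : ℕ) : chebU ρ M k *ᵥ v = chebU ρ z k • v := by
  induction k using Nat.twoStepInduction with
  | zero => simp [chebU]
  | one => exact h
  | more k h1 h2 =>
    simp only [chebU, Matrix.sub_mulVec, Matrix.smul_mulVec, ← Matrix.mulVec_mulVec, h,
      Matrix.mulVec_smul, h1, h2, sub_smul, smul_smul, smul_eq_mul, mul_comm z]

theorem norm_sq_le_sum_norm_sq_of_mulVec {κ : Type*} [Fintype κ] {M : Matrix κ κ ℂ} {z : ℂ}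
    {v : κ → ℂ} (hv : v ≠ 0) (h : M *ᵥ v = z • v) : ‖z‖ ^ 2 ≤ ∑ x, ∑ y, ‖M y x‖ ^ 2 := by
  set n := ∑ x, ‖v x‖ ^ 2 with hn
  have hn0 : 0 < n := by
    obtain ⟨x, hx⟩ := Function.ne_iff.mp hv
    refine Finset.sum_pos' (fun i _ => by positivity) ⟨x, Finset.mem_univ x, ?_⟩
    have : 0 < ‖v x‖ := norm_pos_iff.mpr hx
    positivity
  have h1 : ∀ y, ‖(M *ᵥ v) y‖ ^ 2 ≤ (∑ x, ‖M y x‖ ^ 2) * n := by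
    intro y
    have : ‖(M *ᵥ v) y‖ ≤ ∑ x, ‖M y x‖ * ‖v x‖ :=
      norm_sum_le_of_le _ fun x _ => (norm_mul _ _).le
    calc _ ≤ (∑ x, ‖M y x‖ * ‖v x‖) ^ 2 := by gcongr
      _ ≤ _ := Finset.sum_mul_sq_le_sq_mul_sq _ _ _
  have h2 : ‖z‖ ^ 2 * n ≤ (∑ x, ∑ y, ‖M y x‖ ^ 2) * n := by
    rw [Finset.sum_comm, Finset.sum_mul, hn, Finset.mul_sum, ← hn]
    refine Finset.sum_le_sum fun y _ => ?_
    have := h1 y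
    rwa [h, Pi.smul_apply, norm_smul, mul_pow] at this
  exact le_of_mul_le_mul_right h2 hn0

theorem norm_sq_chebU_le_of_mem_eigs (ρ : ℂ) {N : ℕ} {M : Matrix (Fin N) (Fin N) ℂ} {z : ℂ}
    (hz : z ∈ eigs M) (k : ℕ) :
    ‖chebU ρ z k‖ ^ 2 ≤ ∑ x, ∑ y, ‖chebU ρ M k y x‖ ^ 2 := by
  obtain ⟨v, hv, h⟩ := exists_mulVec_eq_smul_of_mem_eigs hz
  exact norm_sq_le_sum_norm_sq_of_mulVec hv (chebU_mulVec_eq_smul ρ h k)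

theorem chebU_mul_sub (x y : ℂ) (k : ℕ) :
    chebU (x * y) (x + y) k * (x - y) = x ^ (k + 1) - y ^ (k + 1) := by
  induction k using Nat.twoStepInduction with
  | zero => simp [chebU]
  | one => simp only [chebU]; ring
  | more k h1 h2 =>
    have : chebU (x * y) (x + y) (k + 2) * (x - y)
        = (x + y) * (chebU (x * y) (x + y) (k + 1) * (x - y))
          - x * y * (chebU (x * y) (x + y) k * (x - y)) := by
      simp only [chebU, smul_eq_mul]; ring
    rw [this, h1, h2]
    ring

theorem exists_add_mul_of_norm_le (z ρ : ℂ) :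
    ∃ x y : ℂ, x + y = z ∧ x * y = ρ ∧ ‖y‖ ≤ ‖x‖ := by
  obtain ⟨t, ht⟩ := IsAlgClosed.exists_pow_nat_eq (z ^ 2 - 4 * ρ) (n := 2) (by norm_num)
  have h1 : (z + t) / 2 + (z - t) / 2 = z := by ring
  have h2 : (z + t) / 2 * ((z - t) / 2) = ρ := by linear_combination -ht / 4
  rcases le_total ‖(z - t) / 2‖ ‖(z + t) / 2‖ with h | h
  · exact ⟨_, _, h1, h2, h⟩
  · exact ⟨_, _, (add_comm _ _).trans h1, (mul_comm _ _).trans h2, h⟩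

theorem norm_le_of_norm_chebU_le {x y : ℂ} (hxy : ‖x * y‖ ≤ 1)
    {k : ℕ} {B δ : ℝ} (hδ : 0 ≤ δ) (hB : 0 ≤ B) (hU : ‖chebU (x * y) (x + y) k‖ ≤ B)
    (hk : 1 + 2 * B < (1 + δ) ^ k) : ‖x‖ ≤ 1 + δ := by
  by_contra! hr
  have hr1 : 1 ≤ ‖x‖ := by linarith
  have hy : ‖y‖ ≤ 1 := by
    rw [norm_mul] at hxy
    nlinarith [norm_nonneg y]
  have h1 : ‖x‖ ^ (k + 1) ≤ 1 + B * (‖x‖ + 1) := by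
    have e : x ^ (k + 1) = chebU (x * y) (x + y) k * (x - y) + y ^ (k + 1) := by
      rw [chebU_mul_sub]; ring
    rw [← norm_pow, e]
    refine (norm_add_le _ _).trans ?_
    rw [norm_mul, norm_pow, add_comm]
    refine add_le_add (pow_le_one₀ (norm_nonneg _) hy) ?_
    refine mul_le_mul hU ((norm_sub_le _ _).trans (by linarith)) (norm_nonneg _) hB
  have h2 : ‖x‖ ^ k ≤ 1 + 2 * B := by
    have : ‖x‖ ^ k * ‖x‖ ≤ (1 + 2 * B) * ‖x‖ := by
      rw [← pow_succ]; nlinarith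
    exact le_of_mul_le_mul_right this (by linarith)
  have h3 : (1 + δ) ^ k ≤ ‖x‖ ^ k := by gcongr
  linarith

theorem exists_mem_ellipticSet_dist_le {x y : ℂ} (hyx : ‖y‖ ≤ ‖x‖) (hxy : ‖x * y‖ ≤ 1) {δ : ℝ}
    (hδ : 0 ≤ δ) (hx : ‖x‖ ≤ 1 + δ) :
    ∃ w ∈ ellipticSet (x * y), dist (x + y) w ≤ 2 * δ := by
  rcases le_or_gt 1 ‖x‖ with h1 | h1
  · set r := ‖x‖ with hr
    have hr0 : (r : ℂ) ≠ 0 := by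
      have : r ≠ 0 := by linarith
      exact_mod_cast this
    have hxx : conj x * x = (r : ℂ) ^ 2 := by rw [Complex.conj_mul']
    refine ⟨x / r + x * y * conj (x / r), ⟨x / r, ?_, rfl⟩, ?_⟩
    · rw [norm_div, Complex.norm_real, Real.norm_of_nonneg (by linarith), ← hr,
        div_self (by linarith)]
    · have e : x + y - (x / r + x * y * conj (x / r)) = (1 - r⁻¹ : ℝ) * x - (r - 1 : ℝ) * y := by
        rw [map_div₀, Complex.conj_ofReal]
        push_cast
        field_simp
        linear_combination -y * hxx
      rw [dist_eq_norm, e]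
      refine (norm_sub_le _ _).trans ?_
      rw [norm_mul, norm_mul, Complex.norm_real, Complex.norm_real,
        Real.norm_of_nonneg (sub_nonneg.mpr (inv_le_one_of_one_le₀ h1)),
        Real.norm_of_nonneg (sub_nonneg.mpr h1), ← hr]
      have h2 : (1 - r⁻¹) * r = r - 1 := by field_simp
      have hy : ‖y‖ ≤ 1 := by
        rw [norm_mul] at hxy
        nlinarith [norm_nonneg y]
      rw [h2]
      nlinarith
  · refine ⟨x + y, ?_, by simpa using hδ⟩
    set s := ‖x‖ with hs
    set t := ‖y‖ with ht
    have hs0 : 0 ≤ s := norm_nonneg x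
    have ht0 : 0 ≤ t := norm_nonneg y
    have hst : s * t < 1 := by nlinarith
    have hx2 : conj x * x = (s : ℂ) ^ 2 := by rw [Complex.conj_mul']
    have hy2 : conj y * y = (t : ℂ) ^ 2 := by rw [Complex.conj_mul']
    have hD : (0 : ℝ) < 1 - s ^ 2 * t ^ 2 := by
      have : s ^ 2 * t ^ 2 = (s * t) * (s * t) := by ring
      have h0 : 0 ≤ s * t := by positivity
      nlinarith
    have hDc : ((1 - s ^ 2 * t ^ 2 : ℝ) : ℂ) ≠ 0 := by exact_mod_cast hD.ne'
    set w := (x * ((1 - t ^ 2 : ℝ) : ℂ) + y * ((1 - s ^ 2 : ℝ) : ℂ)) / ((1 - s ^ 2 * t ^ 2 : ℝ) : ℂ)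
      with hw
    refine ⟨w, ?_, ?_⟩
    · rw [hw, norm_div, Complex.norm_real, Real.norm_of_nonneg hD.le, div_le_one hD]
      refine (norm_add_le _ _).trans ?_
      rw [norm_mul, norm_mul, Complex.norm_real, Complex.norm_real,
        Real.norm_of_nonneg (by nlinarith), Real.norm_of_nonneg (by nlinarith), ← hs, ← ht]
      nlinarith [mul_nonneg (mul_nonneg (sub_nonneg.mpr h1.le)
        (sub_nonneg.mpr (hyx.trans h1.le))) (sub_nonneg.mpr hst.le)]
    · have hwD : w * ((1 - s ^ 2 * t ^ 2 : ℝ) : ℂ)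
          = x * ((1 - t ^ 2 : ℝ) : ℂ) + y * ((1 - s ^ 2 : ℝ) : ℂ) := div_mul_cancel₀ _ hDc
      have hwD' := congrArg conj hwD
      simp only [map_add, map_mul, Complex.conj_ofReal] at hwD'
      apply mul_right_cancel₀ hDc
      rw [add_mul _ (x * y * conj w), mul_assoc (x * y), hwD, hwD']
      push_cast
      linear_combination (-y * (1 - t ^ 2 : ℂ)) * hx2 - x * (1 - s ^ 2 : ℂ) * hy2

/-- A point where some Chebyshev polynomial is small is close to the elliptic region. -/
theorem mem_ellipticNbhd_of_norm_chebU_le {ρ z : ℂ} (hρ : ‖ρ‖ ≤ 1) {k : ℕ} {B δ : ℝ}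
    (hδ : 0 ≤ δ) (hB : 0 ≤ B) (hU : ‖chebU ρ z k‖ ≤ B) (hk : 1 + 2 * B < (1 + δ) ^ k) :
    z ∈ ellipticNbhd ρ (2 * δ) := by
  obtain ⟨x, y, rfl, rfl, hyx⟩ := exists_add_mul_of_norm_le z ρ
  obtain ⟨w, hw, hd⟩ := exists_mem_ellipticSet_dist_le hyx hρ hδ
    (norm_le_of_norm_chebU_le hρ hδ hB hU hk)
  exact (Metric.infDist_le_dist_of_mem hw).trans hd

end Eigenvalues

section Model

open scoped ComplexConjugate

section Moments

variable {ι : Type*} [Fintype ι]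

/-- The linear polynomial with coefficient vector `u`. -/
def linPoly (u : ι → ℂ) : MvPolynomial ι ℂ := ∑ i, u i • MvPolynomial.X i

theorem evalReal_linPoly (u : ι → ℂ) (x : ι → ℝ) :
    evalReal x (linPoly u) = ∑ i, (x i : ℂ) * u i := by
  simp [linPoly, evalReal, mul_comm]

theorem gaussExp_sum {J : Type*} (t : Finset J) (p : J → MvPolynomial ι ℂ) :
    gaussExp (∑ j ∈ t, p j) = ∑ j ∈ t, gaussExp (p j) := by
  simp only [gaussExp, map_sum]
  exact integral_finsetSum _ fun j _ => integrable_evalReal (p j)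

theorem gaussExp_one : gaussExp (1 : MvPolynomial ι ℂ) = 1 := by
  simp [gaussExp]

theorem gaussExp_linPoly (u : ι → ℂ) : gaussExp (linPoly u) = 0 := by
  rw [linPoly, gaussExp_sum]
  refine Finset.sum_eq_zero fun i _ => ?_
  rw [gaussExp_smul, ← mul_one (MvPolynomial.X i), gaussExp_X_mul, MvPolynomial.pderiv_one]
  simp [gaussExp]

theorem gaussExp_linPoly_mul (u v : ι → ℂ) :
    gaussExp (linPoly u * linPoly v) = ∑ i, u i * v i := by
  have h : ∀ i, MvPolynomial.pderiv i (linPoly v) = v i • 1 := by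
    intro i
    rw [linPoly, map_sum, Finset.sum_eq_single i]
    · simp
    · intro j _ hj
      rw [Derivation.map_smul, MvPolynomial.pderiv_X_of_ne hj, smul_zero]
    · simp
  conv_lhs => rw [linPoly, Finset.sum_mul, gaussExp_sum]
  refine Finset.sum_congr rfl fun i _ => ?_
  rw [smul_mul_assoc, gaussExp_smul, gaussExp_X_mul, h, gaussExp_smul, gaussExp_one, mul_one]

variable {Ω : Type*} [MeasurableSpace Ω] {μ : Measure Ω} {g : ι → Ω → ℝ}

theorem integral_evalReal_comp (hg : ∀ i, Measurable (g i))
    (hlaw : μ.map (fun ω i => g i ω) = stdGaussianPi ι) (p : MvPolynomial ι ℂ) :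
    ∫ ω, evalReal (fun i => g i ω) p ∂μ = gaussExp p := by
  have hm : Measurable (fun ω i => g i ω) := measurable_pi_lambda _ hg
  rw [gaussExp, ← hlaw, integral_map hm.aemeasurable]
  rw [hlaw]
  exact (integrable_evalReal p).aestronglyMeasurable

theorem integral_lin (hg : ∀ i, Measurable (g i))
    (hlaw : μ.map (fun ω i => g i ω) = stdGaussianPi ι) (u : ι → ℂ) :
    ∫ ω, (∑ i, (g i ω : ℂ) * u i) ∂μ = 0 := by
  rw [← gaussExp_linPoly u, ← integral_evalReal_comp hg hlaw]
  simp only [evalReal_linPoly]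

theorem integral_lin_mul_lin (hg : ∀ i, Measurable (g i))
    (hlaw : μ.map (fun ω i => g i ω) = stdGaussianPi ι) (u v : ι → ℂ) :
    ∫ ω, (∑ i, (g i ω : ℂ) * u i) * (∑ i, (g i ω : ℂ) * v i) ∂μ = ∑ i, u i * v i := by
  rw [← gaussExp_linPoly_mul, ← integral_evalReal_comp hg hlaw]
  simp only [map_mul, evalReal_linPoly]

theorem integral_conj_lin_mul_lin (hg : ∀ i, Measurable (g i))
    (hlaw : μ.map (fun ω i => g i ω) = stdGaussianPi ι) (u v : ι → ℂ) :
    ∫ ω, conj (∑ i, (g i ω : ℂ) * u i) * (∑ i, (g i ω : ℂ) * v i) ∂μ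
      = ∑ i, conj (u i) * v i := by
  rw [← integral_lin_mul_lin hg hlaw]
  simp only [map_sum, map_mul, Complex.conj_ofReal]

theorem integral_norm_sq_lin (hg : ∀ i, Measurable (g i))
    (hlaw : μ.map (fun ω i => g i ω) = stdGaussianPi ι) (u : ι → ℂ) :
    ∫ ω, ‖∑ i, (g i ω : ℂ) * u i‖ ^ 2 ∂μ = ∑ i, ‖u i‖ ^ 2 := by
  have h := integral_conj_lin_mul_lin hg hlaw u u
  simp only [Complex.conj_mul', ← Complex.ofReal_pow] at h
  rw [integral_complex_ofReal] at h
  exact_mod_cast h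

end Moments

variable {Ω : Type} [MeasurableSpace Ω] {μ : Measure Ω} {ρ : ℂ} {d : ℕ → ℕ}
  {E : ℕ → Finset (ℕ × ℕ)} {Y : ℕ → ℕ → Ω → ℂ}

theorem EllipticGaussianBandModel.indepFun (h : EllipticGaussianBandModel Ω μ ρ d E Y)
    {x y z w : ℕ} (h1 : (z, w) ≠ (x, y)) (h2 : (z, w) ≠ (y, x)) :
    IndepFun (Y x y) (Y z w) μ := by
  have key : ∀ x y : ℕ, ∃ p : {p : ℕ × ℕ // p.1 ≤ p.2}, ∃ φ : ℂ × ℂ → ℂ, Measurable φ ∧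
      (p.1 = (x, y) ∨ p.1 = (y, x)) ∧
      Y x y = φ ∘ fun ω => (Y p.1.1 p.1.2 ω, Y p.1.2 p.1.1 ω) := by
    intro x y
    rcases le_total x y with hxy | hxy
    · exact ⟨⟨(x, y), hxy⟩, Prod.fst, measurable_fst, Or.inl rfl, rfl⟩
    · exact ⟨⟨(y, x), hxy⟩, Prod.snd, measurable_snd, Or.inr rfl, rfl⟩
  obtain ⟨p, φ, hφ, hp, hpY⟩ := key x y
  obtain ⟨q, χ, hχ, hq, hqY⟩ := key z w
  have hpq : p ≠ q := by
    rintro rfl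
    rcases hp with hp | hp <;> rcases hq with hq | hq <;>
      · rw [hp, Prod.mk.injEq] at hq
        obtain ⟨rfl, rfl⟩ := hq
        first | exact h1 rfl | exact h2 rfl
  rw [hpY, hqY]
  exact (h.edge_indep.indepFun hpq).comp hφ hχ

theorem card_neighbors (h : EllipticGaussianBandModel Ω μ ρ d E Y) (N : ℕ) (x : Fin N) :
    ∑ z : Fin N, (if ((x : ℕ), (z : ℕ)) ∈ E N then (1 : ℝ) else 0) = d N := by
  rw [Fin.sum_univ_eq_sum_range (fun z => if ((x : ℕ), z) ∈ E N then (1 : ℝ) else 0) N,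
    Finset.sum_boole, ← h.degree N x x.2, Nat.cast_inj]
  refine Finset.card_nbij' (fun z => ((x : ℕ), z)) Prod.snd ?_ ?_ ?_ ?_
  · intro z hz
    simp_all
  · rintro ⟨a, z⟩ hz
    simp only [Finset.coe_filter, Set.mem_ofPred_eq] at hz
    obtain ⟨h1, rfl⟩ := hz
    have := (h.edges_lt N _ h1).2
    simp_all
  · intro z _; rfl
  · rintro ⟨a, z⟩ hz
    simp only [Finset.coe_filter, Set.mem_ofPred_eq] at hz
    simp [hz.2]

theorem norm_sum_mul_le {ι : Type*} [Fintype ι] {u v : ι → ℂ} {s : ℝ}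
    (hu : ∑ i, ‖u i‖ ^ 2 ≤ s) (hv : ∑ i, ‖v i‖ ^ 2 ≤ s) : ‖∑ i, u i * v i‖ ≤ s := by
  calc ‖∑ i, u i * v i‖ ≤ ∑ i, (‖u i‖ ^ 2 + ‖v i‖ ^ 2) / 2 := by
        refine norm_sum_le_of_le _ fun i _ => ?_
        rw [norm_mul]
        nlinarith [sq_nonneg (‖u i‖ - ‖v i‖)]
    _ ≤ s := by
        rw [← Finset.sum_div, Finset.sum_add_distrib]; linarith

/-- The rescaled band matrix is a linear function of a standard Gaussian vector, whose
coefficients satisfy the moment conditions. -/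
theorem EllipticGaussianBandModel.exists_bandCoeff [IsProbabilityMeasure μ]
    (h : EllipticGaussianBandModel Ω μ ρ d E Y) {N : ℕ} (hN : 1 ≤ N) :
    ∃ (n : ℕ) (b : Fin N → Fin N → Fin n → ℂ) (g : Fin n → Ω → ℝ),
      (∀ i, Measurable (g i)) ∧ μ.map (fun ω i => g i ω) = stdGaussianPi (Fin n) ∧
      (∀ ω, linMat b (fun i => g i ω) = ((Real.sqrt (d N) : ℂ))⁻¹ • bandMatrix Y N ω) ∧
      BandCoeff ((d N : ℝ)⁻¹) b ∧
      (∀ x z w, w ≠ x → ∑ i, b x z i * b z w i = 0) ∧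
      (∀ x, ‖(∑ z, ∑ i, b x z i * b z x i) - ρ‖ ≤ 2 * (d N : ℝ)⁻¹) := by
  obtain ⟨n, A, g, hg, hind, hY⟩ := h.jointly_gaussian N
  have hgm : ∀ i, Measurable (g i) := fun i => (hg i).1
  have hlaw : μ.map (fun ω i => g i ω) = stdGaussianPi (Fin n) := by
    rw [(iIndepFun_iff_map_fun_eq_pi_map fun i => (hgm i).aemeasurable).mp hind, stdGaussianPi]
    congr 1
    funext i
    exact (hg i).2
  have hd : (0 : ℝ) < d N := by exact_mod_cast h.deg_ge N hN
  have hYm : ∀ x y : Fin N, Measurable (Y x y) := by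
    intro x y
    have : Y x y = fun ω => ∑ i, (g i ω : ℂ) * A i x y := funext fun ω => hY ω x y
    rw [this]
    fun_prop
  have hmean : ∀ x y : Fin N, ∫ ω, Y x y ω ∂μ = 0 := by
    intro x y
    simp only [hY]
    exact integral_lin hgm hlaw _
  have hprod : ∀ x y z w : Fin N, ∫ ω, Y x y ω * Y z w ω ∂μ = ∑ i, A i x y * A i z w := by
    intro x y z w
    simp only [hY]
    exact integral_lin_mul_lin hgm hlaw _ _
  have hcprod : ∀ x y z w : Fin N,
      ∫ ω, conj (Y x y ω) * Y z w ω ∂μ = ∑ i, conj (A i x y) * A i z w := by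
    intro x y z w
    simp only [hY]
    exact integral_conj_lin_mul_lin hgm hlaw _ _
  have hvar : ∀ x y : Fin N,
      ∑ i, ‖A i x y‖ ^ 2 = if ((x : ℕ), (y : ℕ)) ∈ E N then (1 : ℝ) else 0 := by
    intro x y
    rw [← integral_norm_sq_lin hgm hlaw]
    simp only [← hY]
    split_ifs with he
    · by_cases hxy : (x : ℕ) = y
      · rw [← hxy] at he ⊢
        exact h.diag_var x ⟨N, he⟩
      · exact h.offdiag_var x y hxy ⟨N, he⟩
    · simp [h.sparsity N x x.2 y y.2 he]
  have hvar_le : ∀ x y : Fin N, ∑ i, ‖A i x y‖ ^ 2 ≤ 1 := by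
    intro x y
    rw [hvar]
    split_ifs <;> norm_num
  have hne : ∀ {x y z w : Fin N}, (z, w) ≠ (x, y) → (z, w) ≠ (y, x) →
      IndepFun (Y x y) (Y z w) μ := by
    intro x y z w h1 h2
    apply h.indepFun
    · simpa [Fin.val_inj] using h1
    · simpa [Fin.val_inj] using h2
  have hz1 : ∀ {x y z w : Fin N}, (z, w) ≠ (x, y) → (z, w) ≠ (y, x) →
      ∑ i, A i x y * A i z w = 0 := by
    intro x y z w h1 h2
    rw [← hprod, (hne h1 h2).integral_fun_mul_eq_mul_integral
      (hYm _ _).aestronglyMeasurable (hYm _ _).aestronglyMeasurable, hmean, zero_mul]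
  have hz2 : ∀ {x y z w : Fin N}, (z, w) ≠ (x, y) → (z, w) ≠ (y, x) →
      ∑ i, conj (A i x y) * A i z w = 0 := by
    intro x y z w h1 h2
    have hc : Measurable (fun z : ℂ => conj z) := Complex.continuous_conj.measurable
    have hi : IndepFun (fun ω => conj (Y x y ω)) (Y z w) μ :=
      (hne h1 h2).comp hc measurable_id
    rw [← hcprod, hi.integral_fun_mul_eq_mul_integral
      (hc.comp (hYm _ _)).aestronglyMeasurable (hYm _ _).aestronglyMeasurable, hmean, mul_zero]
  set r : ℂ := ((Real.sqrt (d N) : ℂ))⁻¹ with hr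
  have hrr : r * r = ((d N : ℝ)⁻¹ : ℝ) := by
    rw [hr, ← mul_inv, ← Complex.ofReal_mul, Real.mul_self_sqrt hd.le, Complex.ofReal_inv]
  have hrc : conj r = r := by rw [hr, map_inv₀, Complex.conj_ofReal]
  have hrn : ‖r‖ ^ 2 = (d N : ℝ)⁻¹ := by
    rw [← norm_pow, sq, hrr, Complex.norm_real, Real.norm_of_nonneg (by positivity)]
  set b : Fin N → Fin N → Fin n → ℂ := fun x y i => r * A i x y with hb
  have hbn : ∀ x y, ∑ i, ‖b x y i‖ ^ 2
      = (d N : ℝ)⁻¹ * if ((x : ℕ), (y : ℕ)) ∈ E N then (1 : ℝ) else 0 := by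
    intro x y
    simp only [hb, norm_mul, mul_pow, hrn, ← Finset.mul_sum, hvar]
  have hbn_le : ∀ x y, ∑ i, ‖b x y i‖ ^ 2 ≤ (d N : ℝ)⁻¹ := by
    intro x y
    rw [hbn]
    split_ifs <;> simp
  have hbb : ∀ x y z w, ∑ i, b x y i * b z w i = ((d N : ℝ)⁻¹ : ℝ) * ∑ i, A i x y * A i z w := by
    intro x y z w
    rw [← hrr, Finset.mul_sum]
    exact Finset.sum_congr rfl fun i _ => by simp only [hb]; ring
  have hcbb : ∀ x y z w, ∑ i, conj (b x y i) * b z w i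
      = ((d N : ℝ)⁻¹ : ℝ) * ∑ i, conj (A i x y) * A i z w := by
    intro x y z w
    rw [← hrr, Finset.mul_sum]
    exact Finset.sum_congr rfl fun i _ => by simp only [hb, map_mul, hrc]; ring
  refine ⟨n, b, g, hgm, hlaw, fun ω => ?_, ⟨⟨by positivity, fun e f => ?_, fun e f h1 h2 => ?_⟩,
    fun x => ?_, fun z => ?_⟩, fun x z w hw => ?_, fun x => ?_⟩
  · ext x y
    simp only [linMat, Matrix.of_apply, Matrix.smul_apply, bandMatrix, hY, smul_eq_mul,
      Finset.mul_sum, hb]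
    exact Finset.sum_congr rfl fun i _ => by ring
  · exact norm_sum_mul_le (by simpa using hbn_le e.1 e.2) (hbn_le f.1 f.2)
  · rw [hcbb, hz2 h1 h2, mul_zero]
  · simp only [hbn]
    rw [← Finset.mul_sum, card_neighbors h, inv_mul_cancel₀ hd.ne']
  · simp only [hbn, fun x : Fin N => h.edges_symm N x z]
    rw [← Finset.mul_sum, card_neighbors h, inv_mul_cancel₀ hd.ne']
  · rw [hbb, hz1, mul_zero]
    · intro h1
      rw [Prod.mk.injEq] at h1
      exact hw (h1.2.trans h1.1)
    · intro h1
      rw [Prod.mk.injEq] at h1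
      exact hw h1.2
  · have hρ : ρ = ((d N : ℝ)⁻¹ : ℝ) *
        ∑ z : Fin N, ρ * ((if ((x : ℕ), (z : ℕ)) ∈ E N then (1 : ℝ) else 0 : ℝ) : ℂ) := by
      rw [← Finset.mul_sum, ← Complex.ofReal_sum, card_neighbors h, mul_left_comm,
        ← Complex.ofReal_mul, inv_mul_cancel₀ hd.ne', Complex.ofReal_one, mul_one]
    simp only [hbb]
    rw [← Finset.mul_sum]
    conv_lhs => rw [hρ]
    rw [← mul_sub, ← Finset.sum_sub_distrib, Finset.sum_eq_single x, norm_mul, Complex.norm_real,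
      Real.norm_of_nonneg (by positivity), mul_comm]
    · gcongr
      refine (norm_sub_le _ _).trans ?_
      have h1 : ‖∑ i, A i x x * A i x x‖ ≤ 1 := norm_sum_mul_le (hvar_le x x) (hvar_le x x)
      have h2 : ‖ρ * ((if ((x : ℕ), (x : ℕ)) ∈ E N then (1 : ℝ) else 0 : ℝ) : ℂ)‖ ≤ 1 := by
        split_ifs
        · simpa using h.rho_le
        · simp
      linarith
    · intro z _ hzx
      have hne' : (x : ℕ) ≠ z := fun h => hzx (Fin.ext h.symm)
      rw [← hprod]
      split_ifs with he
      · rw [h.offdiag_cov x z hne' ⟨N, he⟩]; simp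
      · simp [h.sparsity N x x.2 z z.2 he]
    · simp

end Model

section Conclusion

theorem exists_add_one_sq_mul_pow_le {r : ℝ} (hr0 : 0 < r) (hr1 : r < 1) :
    ∃ C : ℝ, 0 ≤ C ∧ ∀ k : ℕ, ((k : ℝ) + 1) ^ 2 * r ^ k ≤ C := by
  have h := (tendsto_add_atTop_iff_nat 1).mpr
    (tendsto_pow_const_mul_const_pow_of_abs_lt_one 2 (abs_lt.mpr ⟨by linarith, hr1⟩))
  obtain ⟨C, hC⟩ := h.bddAbove_range
  have hC' : ∀ k : ℕ, ((k : ℝ) + 1) ^ 2 * r ^ (k + 1) ≤ C := fun k => by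
    simpa using hC ⟨k, rfl⟩
  refine ⟨C / r, ?_, fun k => ?_⟩
  · have := hC' 0
    norm_num at this
    have : 0 ≤ C := hr0.le.trans this
    positivity
  · rw [le_div_iff₀ hr0, mul_assoc, ← pow_succ]
    exact hC' k

/-- Logarithmically many powers of a contraction factor give a summable polynomial rate. -/
theorem exists_log_mul_le {r : ℝ} (hr0 : 0 < r) (hr1 : r < 1) :
    ∃ K C : ℝ, 0 < K ∧ 0 ≤ C ∧ ∀ N k : ℕ, 1 ≤ N → K * Real.log N ≤ k →
      (N : ℝ) * ((k + 1) * r ^ k) ^ 2 ≤ C * ((N : ℝ) ^ 2)⁻¹ := by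
  obtain ⟨C, hC0, hC⟩ := exists_add_one_sq_mul_pow_le hr0 hr1
  have hlog : Real.log r < 0 := Real.log_neg hr0 hr1
  refine ⟨3 / -Real.log r, C, div_pos (by norm_num) (by linarith), hC0, fun N k hN hk => ?_⟩
  have hN0 : (0 : ℝ) < N := by exact_mod_cast hN
  have hrk : r ^ k ≤ ((N : ℝ) ^ 3)⁻¹ := by
    rw [← Real.log_le_log_iff (by positivity) (by positivity), Real.log_pow, Real.log_inv,
      Real.log_pow]
    rw [div_mul_eq_mul_div, div_le_iff₀ (by linarith)] at hk
    push_cast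
    linarith
  calc (N : ℝ) * ((k + 1) * r ^ k) ^ 2 = N * (((k + 1) ^ 2 * r ^ k) * r ^ k) := by ring
    _ ≤ N * (C * ((N : ℝ) ^ 3)⁻¹) := by gcongr; exact hC k
    _ = C * ((N : ℝ) ^ 2)⁻¹ := by field_simp

/-- The spectral threshold condition holds for logarithmic degree. -/
theorem eventually_one_add_le {d : ℕ → ℕ}
    (hd : Tendsto (fun N => (d N : ℝ) / (Real.log N) ^ 3) atTop atTop)
    {K τ : ℝ} (hK : 0 < K) (hτ : 1 < τ) :
    ∀ᶠ N : ℕ in atTop, let k := ⌈K * Real.log N⌉₊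
      1 + (k : ℝ) * (d N : ℝ)⁻¹ + (2 * k + 4) * (d N : ℝ)⁻¹ * k ≤ τ := by
  have hlog : Tendsto (fun N : ℕ => Real.log N) atTop atTop :=
    Real.tendsto_log_atTop.comp tendsto_natCast_atTop_atTop
  filter_upwards [hd.eventually_ge_atTop (28 * K ^ 2 / (τ - 1)), hlog.eventually_ge_atTop 1,
    hlog.eventually_ge_atTop (1 / K)] with N h1 h2 h3
  intro k
  set l := Real.log N
  have hKl : 1 ≤ K * l := by rwa [div_le_iff₀' hK] at h3
  have hk1 : (1 : ℝ) ≤ k := hKl.trans (Nat.le_ceil _)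
  have hk2 : (k : ℝ) ≤ 2 * (K * l) := by
    have := Nat.ceil_lt_add_one (zero_le_one.trans hKl)
    change (k : ℝ) < _ at this
    linarith
  have hτ' : 0 < τ - 1 := by linarith
  have hl3 : 0 < l ^ 3 := by positivity
  rw [div_le_div_iff₀ hτ' hl3] at h1
  have hl23 : l ^ 2 ≤ l ^ 3 := pow_le_pow_right₀ h2 (by norm_num)
  have hdpos : (0 : ℝ) < d N := by
    have : 0 < (d N : ℝ) * (τ - 1) := lt_of_lt_of_le (by positivity) h1
    exact pos_of_mul_pos_left this hτ'.le
  have hkk : (k : ℝ) ^ 2 ≤ 4 * K ^ 2 * l ^ 2 := by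
    calc (k : ℝ) ^ 2 ≤ (2 * (K * l)) ^ 2 := by gcongr
      _ = _ := by ring
  have hmain : (k : ℝ) + (2 * k + 4) * k ≤ (τ - 1) * d N := by
    have h4 : 28 * K ^ 2 * l ^ 2 ≤ 28 * K ^ 2 * l ^ 3 := by gcongr
    nlinarith
  have : (k : ℝ) * (d N : ℝ)⁻¹ + (2 * k + 4) * (d N : ℝ)⁻¹ * k
      = (k + (2 * k + 4) * k) * (d N : ℝ)⁻¹ := by ring
  have h5 : ((k : ℝ) + (2 * k + 4) * k) * (d N : ℝ)⁻¹ ≤ τ - 1 := by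
    rwa [← div_eq_mul_inv, div_le_iff₀ hdpos]
  linarith

theorem eventually_one_add_two_mul_pow_lt {σ t : ℝ} (hσ : 1 < σ) (ht : σ < t) :
    ∀ᶠ k : ℕ in atTop, 1 + 2 * σ ^ k < t ^ k := by
  have hσ0 : 0 < σ := by linarith
  have h := (tendsto_pow_atTop_atTop_of_one_lt ((one_lt_div hσ0).mpr ht)).eventually_gt_atTop 3
  filter_upwards [h] with k hk
  rw [div_pow, lt_div_iff₀ (by positivity)] at hk
  linarith [one_le_pow₀ hσ.le (n := k)]

variable {Ω : Type} [MeasurableSpace Ω] {μ : Measure Ω} {ρ : ℂ} {d : ℕ → ℕ}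
  {E : ℕ → Finset (ℕ × ℕ)} {Y : ℕ → ℕ → Ω → ℂ}

/-- Markov bound for the Hilbert–Schmidt norm of the Chebyshev polynomials of the rescaled
band matrix. -/
theorem EllipticGaussianBandModel.measure_chebU_ge_le [IsProbabilityMeasure μ]
    (h : EllipticGaussianBandModel Ω μ ρ d E Y) {N k : ℕ} {σ τ : ℝ} (hN : 1 ≤ N) (hσ : 0 < σ)
    (hτ : 1 + (k : ℝ) * (d N : ℝ)⁻¹ + (2 * k + 4) * (d N : ℝ)⁻¹ * k ≤ τ) :
    μ {ω | (σ ^ k) ^ 2 ≤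
        ∑ z, ∑ y, ‖chebU ρ (((Real.sqrt (d N) : ℂ))⁻¹ • bandMatrix Y N ω) k y z‖ ^ 2}
      ≤ ENNReal.ofReal (N * ((k + 1) * (τ / σ) ^ k) ^ 2) := by
  obtain ⟨n, b, g, hg, hlaw, hlin, hb, hzero, hcov⟩ := h.exists_bandCoeff hN
  obtain ⟨hInt, hle⟩ := integral_sum_norm_sq_chebU_le hb hzero hcov hτ
  have hm : AEMeasurable (fun ω i => g i ω) μ := (measurable_pi_lambda _ hg).aemeasurable
  rw [← hlaw] at hInt hle
  rw [integral_map hm hInt.aestronglyMeasurable] at hle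
  have hInt' := hInt.comp_aemeasurable hm
  simp only [Function.comp_def, hlin] at hInt' hle
  have hmk := mul_meas_ge_le_integral_of_nonneg
    (Eventually.of_forall fun ω => by positivity) hInt' ((σ ^ k) ^ 2)
  rw [ENNReal.le_ofReal_iff_toReal_le (measure_ne_top _ _) (by positivity)]
  have hσk : 0 < (σ ^ k) ^ 2 := by positivity
  rw [← mul_le_mul_iff_right₀ hσk]
  refine (hmk.trans hle).trans_eq ?_
  rw [Fintype.card_fin, div_pow]
  field_simp

end Conclusion

/-- Theorem 1.4 (1), Gaussian case: almost surely, eventually in N, all eigenvalues of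
d_N^{−1/2}·X_N lie in 𝓔_{ρ,ε}. -/
theorem stmt8 (Ω : Type) [MeasurableSpace Ω] (μ : Measure Ω) [IsProbabilityMeasure μ]
    (ρ : ℂ) (hρ : ‖ρ‖ ≤ 1)
    (d : ℕ → ℕ) (E : ℕ → Finset (ℕ × ℕ)) (Y : ℕ → ℕ → Ω → ℂ)
    (hmodel : EllipticGaussianBandModel Ω μ ρ d E Y)
    (ε : ℝ) (hε : 0 < ε) :
    ∀ᵐ ω ∂μ, ∀ᶠ N in atTop,
      ∀ z ∈ eigs (((Real.sqrt (d N) : ℂ))⁻¹ • bandMatrix Y N ω), z ∈ ellipticNbhd ρ ε := by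
  obtain ⟨τ, hτ1, hτ⟩ := exists_between (show (1 : ℝ) < 1 + ε / 2 by linarith)
  obtain ⟨σ, hτσ, hσ⟩ := exists_between hτ
  have hσ1 : 1 < σ := hτ1.trans hτσ
  have hσ0 : 0 < σ := by linarith
  obtain ⟨K, C, hK, hC, hKC⟩ := exists_log_mul_le (r := τ / σ)
    (div_pos (by linarith) hσ0) ((div_lt_one hσ0).mpr hτσ)
  let k : ℕ → ℕ := fun N => ⌈K * Real.log N⌉₊
  have hk : Tendsto k atTop atTop := tendsto_nat_ceil_atTop.comp
    ((Real.tendsto_log_atTop.comp tendsto_natCast_atTop_atTop).const_mul_atTop hK)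
  obtain ⟨N₀, hN₀⟩ := eventually_atTop.mp
    (eventually_one_add_le hmodel.deg_growth hK hτ1)
  let bad : ℕ → Set Ω := fun N => {ω | N₀ ≤ N ∧ 1 ≤ N ∧ (σ ^ k N) ^ 2 ≤
    ∑ z, ∑ y, ‖chebU ρ (((Real.sqrt (d N) : ℂ))⁻¹ • bandMatrix Y N ω) (k N) y z‖ ^ 2}
  have hbad : ∀ N, μ (bad N) ≤ ENNReal.ofReal (C * ((N : ℝ) ^ 2)⁻¹) := by
    intro N
    by_cases hN : N₀ ≤ N ∧ 1 ≤ N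
    · calc μ (bad N) ≤ _ := measure_mono fun ω hω => hω.2.2
        _ ≤ _ := hmodel.measure_chebU_ge_le hN.2 hσ0 (hN₀ N hN.1)
        _ ≤ _ := ENNReal.ofReal_le_ofReal (hKC N (k N) hN.2 (Nat.le_ceil _))
    · have : bad N = ∅ := Set.eq_empty_of_forall_notMem fun ω hω => hN ⟨hω.1, hω.2.1⟩
      simp [this]
  have hsum : ∑' N, μ (bad N) ≠ ∞ := by
    have hs : Summable fun N : ℕ => C * ((N : ℝ) ^ 2)⁻¹ :=
      (Real.summable_nat_pow_inv.mpr one_lt_two).mul_left C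
    exact ne_top_of_le_ne_top hs.tsum_ofReal_ne_top (ENNReal.tsum_le_tsum hbad)
  filter_upwards [ae_eventually_notMem hsum] with ω hω
  filter_upwards [hω, eventually_ge_atTop N₀, eventually_ge_atTop 1,
    hk.eventually (eventually_one_add_two_mul_pow_lt hσ1 hσ)] with N h1 h2 h3 h4 z hz
  have hlt : ∑ z, ∑ y, ‖chebU ρ (((Real.sqrt (d N) : ℂ))⁻¹ • bandMatrix Y N ω) (k N) y z‖ ^ 2
      < (σ ^ k N) ^ 2 := not_le.mp fun hle => h1 ⟨h2, h3, hle⟩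
  have hU : ‖chebU ρ z (k N)‖ ≤ σ ^ k N :=
    le_of_sq_le_sq ((norm_sq_chebU_le_of_mem_eigs ρ hz (k N)).trans hlt.le) (by positivity)
  have := mem_ellipticNbhd_of_norm_chebU_le hρ (by positivity) (by positivity) hU h4
  rwa [mul_div_cancel₀ ε two_ne_zero] at this

end
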